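/- Let H be a Hopf algebra over a field k with bijective antipode. If H is left ℵ₀-noetherian (every left ideal is countably generated), then l.silp(H) = l.spli(H). -/

import Mathlib

open TensorProduct

universe u

noncomputable section GorensteinCore

/-- `ProjDimLE R n M` : the left `R`-module `M` has a projective resolution of length `≤ n`. -/
def ProjDimLE (R : Type u) [Ring R] : ℕ → (M : Type u) → [AddCommGroup M] → [Module R M] → Prop
  | 0, M, _, _ => Module.Projective R M
  | (n+1), M, _, _ => Module.Projective R M ∨
      ∃ (P : ModuleCat.{u} R) (f : P →ₗ[R] M), Module.Projective R P ∧
      Function.Surjective f ∧ ProjDimLE R n (LinearMap.ker f)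

/-- The projective dimension of a module, as an element of `ℕ∞` (`⊤` = infinite). -/
def projDim (R : Type u) [Ring R] (M : Type u) [AddCommGroup M] [Module R M] : ℕ∞ :=
  sInf {n : ℕ∞ | ∃ m : ℕ, n = (m : ℕ∞) ∧ ProjDimLE R m M}

/-- A module is Gorenstein projective if it is a syzygy of a totally acyclic complex of
projective modules. -/
def IsGorensteinProjective (R : Type u) [Ring R] (M : Type u) [AddCommGroup M] [Module R M] :
    Prop :=
  ∃ (P : ℤ → ModuleCat.{u} R) (d : ∀ i : ℤ, P (i+1) →ₗ[R] P i),
    (∀ i, Module.Projective R (P i)) ∧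
    (∀ i, LinearMap.range (d (i+1)) = LinearMap.ker (d i)) ∧
    (∀ (Q : ModuleCat.{u} R), Module.Projective R Q →
      ∀ (i : ℤ) (f : P (i+1) →ₗ[R] Q), f.comp (d (i+1)) = 0 →
        ∃ g : P i →ₗ[R] Q, g.comp (d i) = f) ∧
    Nonempty (M ≃ₗ[R] LinearMap.ker (d 0))

/-- `GProjDimLE R n M` : `M` has a Gorenstein projective resolution of length `≤ n`. -/
def GProjDimLE (R : Type u) [Ring R] : ℕ → (M : Type u) → [AddCommGroup M] → [Module R M] → Prop
  | 0, M, _, _ => IsGorensteinProjective R M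
  | (n+1), M, _, _ => IsGorensteinProjective R M ∨
      ∃ (G : ModuleCat.{u} R) (f : G →ₗ[R] M), IsGorensteinProjective R G ∧
      Function.Surjective f ∧ GProjDimLE R n (LinearMap.ker f)

/-- The Gorenstein projective dimension of a module, as an element of `ℕ∞`. -/
def gProjDim (R : Type u) [Ring R] (M : Type u) [AddCommGroup M] [Module R M] : ℕ∞ :=
  sInf {n : ℕ∞ | ∃ m : ℕ, n = (m : ℕ∞) ∧ GProjDimLE R m M}

/-- The (left) Gorenstein global dimension of a ring `R`. -/
def lGgldim (R : Type u) [Ring R] : ℕ∞ :=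
  ⨆ M : ModuleCat.{u} R, gProjDim R M

/-- The (left) global dimension of a ring `R`. -/
def lgldim (R : Type u) [Ring R] : ℕ∞ :=
  ⨆ M : ModuleCat.{u} R, projDim R M

/-- `InjDimLE R n M` : the left `R`-module `M` has an injective resolution of length `≤ n`. -/
def InjDimLE (R : Type u) [Ring R] : ℕ → (M : Type u) → [AddCommGroup M] → [Module R M] → Prop
  | 0, M, _, _ => Module.Injective R M
  | (n+1), M, _, _ => Module.Injective R M ∨
      ∃ (I : ModuleCat.{u} R) (f : M →ₗ[R] I), Module.Injective R I ∧
      Function.Injective f ∧ InjDimLE R n (I ⧸ LinearMap.range f)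

/-- The injective dimension of a module, as an element of `ℕ∞`. -/
def injDim (R : Type u) [Ring R] (M : Type u) [AddCommGroup M] [Module R M] : ℕ∞ :=
  sInf {n : ℕ∞ | ∃ m : ℕ, n = (m : ℕ∞) ∧ InjDimLE R m M}

/-- `silp R` : the supremum of the injective dimensions of projective left `R`-modules. -/
def silp (R : Type u) [Ring R] : ℕ∞ :=
  ⨆ (M : ModuleCat.{u} R) (_ : Module.Projective R M), injDim R M

/-- `spli R` : the supremum of the projective dimensions of injective left `R`-modules. -/
def spli (R : Type u) [Ring R] : ℕ∞ :=
  ⨆ (M : ModuleCat.{u} R) (_ : Module.Injective R M), projDim R M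

end GorensteinCore
noncomputable section HopfCore

variable (k : Type u) [CommRing k] (H : Type u) [Ring H] [HopfAlgebra k H]

/-- The trivial left `H`-module structure on `k`, given by the counit. -/
def trivModule : Module H k :=
  Module.compHom k ((Bialgebra.counitAlgHom k H : H →ₐ[k] k) : H →+* k)

/-- The trivial left `H`-module `εk`, as an object of `ModuleCat H`. -/
def trivMod : ModuleCat.{u} H :=
  @ModuleCat.of H _ k _ (trivModule k H)

/-- The counit of `H`, as a ring homomorphism out of `Hᵐᵒᵖ`. -/
def counitOp : Hᵐᵒᵖ →+* k :=
  RingHom.fromOpposite ((Bialgebra.counitAlgHom k H : H →ₐ[k] k) : H →+* k)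
    (fun _ _ => mul_comm _ _)

/-- The trivial right `H`-module structure on `k` (as a left `Hᵐᵒᵖ`-module). -/
def trivModuleOp : Module Hᵐᵒᵖ k :=
  Module.compHom k (counitOp k H)

/-- The trivial right `H`-module `k_ε`, as an object of `ModuleCat Hᵐᵒᵖ`. -/
def trivModOp : ModuleCat.{u} Hᵐᵒᵖ :=
  @ModuleCat.of Hᵐᵒᵖ _ k _ (trivModuleOp k H)

section TensorAction

variable (M N : Type u) [AddCommGroup M] [Module k M] [Module H M]
  [IsScalarTower k H M] [SMulCommClass k H M]
  [AddCommGroup N] [Module k N] [Module H N] [IsScalarTower k H N] [SMulCommClass k H N]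

/-- The representation of `H` on a left `H`-module `M`, as an algebra morphism to
`End_k(M)`. -/
def hRep : H →ₐ[k] Module.End k M :=
  (Algebra.lsmul k k M : H →ₐ[k] Module.End k M)

/-- The representation of `H` on `M ⊗[k] N` given by the comultiplication of `H`:
`h • (m ⊗ n) = ∑ h₁ • m ⊗ h₂ • n`. -/
def tensorRep : H →ₐ[k] Module.End k (M ⊗[k] N) :=
  ((Module.endTensorEndAlgHom (R := k) (S := k) (A := k) (M := M) (N := N)).comp
    (Algebra.TensorProduct.map (hRep k H M) (hRep k H N))).comp
    (Bialgebra.comulAlgHom k H)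

/-- The diagonal left `H`-module structure on `M ⊗[k] N`:
`h • (m ⊗ n) = ∑ h₁ • m ⊗ h₂ • n`. -/
def tensorModule : Module H (M ⊗[k] N) :=
  Module.compHom (M ⊗[k] N)
    ((tensorRep k H M N).toRingHom : H →+* Module.End k (M ⊗[k] N))

/-- The tensor product `M ⊗[k] N` with its diagonal left `H`-module structure, as an
object of `ModuleCat H`. -/
def tensorMod : ModuleCat.{u} H :=
  @ModuleCat.of H _ (M ⊗[k] N) _ (tensorModule k H M N)

end TensorAction

end HopfCore


/-- A ring is left `ℵ₀`-noetherian if every left ideal is countably generated. -/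
def IsLeftAleph0Noetherian (R : Type u) [Ring R] : Prop :=
  ∀ I : Submodule R R, ∃ s : Set R, s.Countable ∧ Submodule.span R s = I

section ExtVanishing

open CategoryTheory Abelian

variable (R : Type u) [Ring R]

/-- `ExtVanish R M N n` : the group `Ext^n_R(M, N)` is trivial. -/
def ExtVanish (M N : Type u) [AddCommGroup M] [Module R M] [AddCommGroup N] [Module R N]
    (n : ℕ) : Prop :=
  Subsingleton (Ext (ModuleCat.of R M) (ModuleCat.of R N) n)

variable {R}
variable {A B C X : Type u} [AddCommGroup A] [Module R A] [AddCommGroup B] [Module R B]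
  [AddCommGroup C] [Module R C] [AddCommGroup X] [Module R X]

theorem extVanish_of_projective [Module.Projective R A] (n : ℕ) : ExtVanish R A X (n + 1) := by
  have : Projective (ModuleCat.of R A) := (IsProjective.iff_projective A).1 inferInstance
  exact Ext.subsingleton_of_projective _ _ n

theorem extVanish_of_injective (hX : Module.Injective R X) (n : ℕ) : ExtVanish R A X (n + 1) := by
  have : Injective (ModuleCat.of R X) := Module.injective_object_of_injective_module R X
  exact Ext.subsingleton_of_injective _ _ n

theorem shortExact_of_linearMap {i : A →ₗ[R] B} {f : B →ₗ[R] C} (hi : Function.Injective i)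
    (hf : Function.Surjective f) (hex : Function.Exact i f) :
    (ModuleCat.shortComplexOfCompEqZero i f hex.linearMap_comp_eq_zero).ShortExact :=
  ModuleCat.shortComplex_shortExact _ hex hi hf

section ShortExact

variable {i : A →ₗ[R] B} {f : B →ₗ[R] C} (hi : Function.Injective i)
    (hf : Function.Surjective f) (hex : Function.Exact i f)

include hi hf hex

theorem ExtVanish.left_of_middle {n : ℕ} (h₂ : ExtVanish R B X n)
    (h₃ : ExtVanish R C X (n + 1)) : ExtVanish R A X n := by
  have hS := shortExact_of_linearMap hi hf hex
  refine subsingleton_of_forall_eq 0 fun x => ?_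
  obtain ⟨y, rfl⟩ := Ext.contravariant_sequence_exact₁ hS (ModuleCat.of R X) x (add_comm 1 n)
    (h₃.elim _ _)
  rw [show y = 0 from h₂.elim _ _, Ext.comp_zero]

theorem ExtVanish.right {n : ℕ} (h₁ : ExtVanish R A X n)
    (h₂ : ExtVanish R B X (n + 1)) : ExtVanish R C X (n + 1) := by
  have hS := shortExact_of_linearMap hi hf hex
  refine subsingleton_of_forall_eq 0 fun x => ?_
  obtain ⟨y, rfl⟩ := Ext.contravariant_sequence_exact₃ hS (ModuleCat.of R X) x
    (h₂.elim _ _) (add_comm 1 n)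
  rw [show y = 0 from h₁.elim _ _, Ext.comp_zero]

theorem ExtVanish.snd_right {n : ℕ} (h₂ : ExtVanish R X B n)
    (h₁ : ExtVanish R X A (n + 1)) : ExtVanish R X C n := by
  have hS := shortExact_of_linearMap hi hf hex
  refine subsingleton_of_forall_eq 0 fun x => ?_
  obtain ⟨y, rfl⟩ := Ext.covariant_sequence_exact₃ (ModuleCat.of R X) hS x rfl
    (h₁.elim _ _)
  rw [show y = 0 from h₂.elim _ _, Ext.zero_comp]

theorem ExtVanish.snd_left {n : ℕ} (h₃ : ExtVanish R X C n)
    (h₂ : ExtVanish R X B (n + 1)) : ExtVanish R X A (n + 1) := by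
  have hS := shortExact_of_linearMap hi hf hex
  refine subsingleton_of_forall_eq 0 fun x => ?_
  obtain ⟨y, rfl⟩ := Ext.covariant_sequence_exact₁ (ModuleCat.of R X) hS x
    (h₂.elim _ _) rfl
  rw [show y = 0 from h₃.elim _ _, Ext.zero_comp]

/-- If `Ext¹(C, X) = 0`, then maps to `X` extend along monomorphisms with cokernel `C`. -/
theorem ExtVanish.exists_extension (h : ExtVanish R C X 1) (g : A →ₗ[R] X) :
    ∃ g' : B →ₗ[R] X, g' ∘ₗ i = g := by
  have hS := shortExact_of_linearMap hi hf hex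
  obtain ⟨y, hy⟩ := Ext.contravariant_sequence_exact₁ hS (ModuleCat.of R X)
    (Ext.mk₀ (ModuleCat.ofHom g)) (add_comm 1 0) (h.elim _ _)
  obtain ⟨y, rfl⟩ := (Ext.mk₀_bijective _ _).2 y
  rw [Ext.mk₀_comp_mk₀] at hy
  have := (Ext.mk₀_bijective _ _).1 hy
  exact ⟨y.hom, by ext a; exact congrArg (fun φ => φ.hom a) this⟩

theorem extVanish_one_of_extension (hB : ExtVanish R B X 1)
    (h : ∀ g : A →ₗ[R] X, ∃ g' : B →ₗ[R] X, g' ∘ₗ i = g) : ExtVanish R C X 1 := by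
  have hS := shortExact_of_linearMap hi hf hex
  refine subsingleton_of_forall_eq 0 fun x => ?_
  obtain ⟨y, rfl⟩ := Ext.contravariant_sequence_exact₃ hS (ModuleCat.of R X) x
    (hB.elim _ _) (add_comm 1 0)
  obtain ⟨y, rfl⟩ := (Ext.mk₀_bijective _ _).2 y
  obtain ⟨g', hg'⟩ := h y.hom
  have : y = (ModuleCat.shortComplexOfCompEqZero i f hex.linearMap_comp_eq_zero).f ≫
      ModuleCat.ofHom g' := by
    ext a; exact (LinearMap.congr_fun hg' a).symm
  rw [this, ← Ext.mk₀_comp_mk₀, ← Ext.comp_assoc_of_second_deg_zero, hS.extClass_comp,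
    Ext.zero_comp]

end ShortExact

end ExtVanishing

section Dimensions

variable (R : Type u) [Ring R]

/-- The tautological free cover of a module. -/
noncomputable def freeCover (M : Type u) [AddCommGroup M] [Module R M] : (M →₀ R) →ₗ[R] M :=
  Finsupp.linearCombination R id

variable {R}

theorem freeCover_surjective (M : Type u) [AddCommGroup M] [Module R M] :
    Function.Surjective (freeCover R M) := fun m => ⟨Finsupp.single m 1, by simp [freeCover]⟩

theorem exact_ker_subtype {A B : Type u} [AddCommGroup A] [Module R A] [AddCommGroup B]
    [Module R B] (f : A →ₗ[R] B) : Function.Exact (LinearMap.ker f).subtype f := by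
  intro x; simp

theorem exact_range_mkQ {A B : Type u} [AddCommGroup A] [Module R A] [AddCommGroup B]
    [Module R B] (f : A →ₗ[R] B) : Function.Exact f (LinearMap.range f).mkQ := by
  intro x; simp

theorem exists_injective_embedding (M : Type u) [AddCommGroup M] [Module R M] :
    ∃ (I : ModuleCat.{u} R) (f : M →ₗ[R] I), Module.Injective R I ∧ Function.Injective f := by
  let I : ModuleCat.{u} R := CategoryTheory.Injective.under (ModuleCat.of R M)
  have : CategoryTheory.Injective (ModuleCat.of R I) :=
    (inferInstance : CategoryTheory.Injective (CategoryTheory.Injective.under (ModuleCat.of R M)))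
  refine ⟨I, (CategoryTheory.Injective.ι (ModuleCat.of R M)).hom,
    Module.injective_module_of_injective_object R I, ?_⟩
  exact (ModuleCat.mono_iff_injective _).1 inferInstance

section Projective

variable {M : Type u} [AddCommGroup M] [Module R M]

theorem projective_of_extVanish (h : ∀ (X : Type u) [AddCommGroup X] [Module R X],
    ExtVanish R M X 1) : Module.Projective R M := by
  obtain ⟨g, hg⟩ := (h (LinearMap.ker (freeCover R M))).exists_extension
    (Submodule.injective_subtype _) (freeCover_surjective M) (exact_ker_subtype _) LinearMap.id
  have key : LinearMap.ker (freeCover R M) ≤ LinearMap.ker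
      (LinearMap.id - (LinearMap.ker (freeCover R M)).subtype ∘ₗ g) := fun x hx => by
    simpa [sub_eq_zero] using (congrArg Subtype.val (LinearMap.congr_fun hg ⟨x, hx⟩)).symm
  refine Module.Projective.of_split ((Submodule.liftQ _ _ key) ∘ₗ
    ((freeCover R M).quotKerEquivOfSurjective (freeCover_surjective M)).symm.toLinearMap)
    (freeCover R M) ?_
  ext m
  obtain ⟨x, rfl⟩ := ((freeCover R M).quotKerEquivOfSurjective (freeCover_surjective M)).surjective m
  obtain ⟨x, rfl⟩ := Submodule.mkQ_surjective _ x
  simp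

theorem injective_of_extVanish (h : ∀ (X : Type u) [AddCommGroup X] [Module R X],
    ExtVanish R X M 1) : Module.Injective R M := by
  refine ⟨fun X Y _ _ _ _ f hf g => ?_⟩
  obtain ⟨g', hg'⟩ := (h (Y ⧸ LinearMap.range f)).exists_extension hf
    (Submodule.mkQ_surjective _) (exact_range_mkQ f) g
  exact ⟨g', fun x => LinearMap.congr_fun hg' x⟩

variable (M) in
theorem ExtVanish.succ_of_forall_snd {n : ℕ} (h : ∀ (X : Type u) [AddCommGroup X] [Module R X],
    ExtVanish R M X (n + 1)) (X : Type u) [AddCommGroup X] [Module R X] :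
    ExtVanish R M X (n + 2) := by
  obtain ⟨I, f, hI, hf⟩ := exists_injective_embedding (R := R) X
  exact (h (I ⧸ LinearMap.range f)).snd_left hf
    (Submodule.mkQ_surjective _) (exact_range_mkQ f) (extVanish_of_injective hI _)

variable (M) in
theorem ExtVanish.succ_of_forall_fst {n : ℕ} (h : ∀ (X : Type u) [AddCommGroup X] [Module R X],
    ExtVanish R X M (n + 1)) (X : Type u) [AddCommGroup X] [Module R X] :
    ExtVanish R X M (n + 2) :=
  (h (LinearMap.ker (freeCover R X))).right (Submodule.injective_subtype _)
    (freeCover_surjective X) (exact_ker_subtype _) (extVanish_of_projective _)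

end Projective

theorem extVanish_of_le_of_forall_fst (M : Type u) [AddCommGroup M] [Module R M] {n m : ℕ}
    (hnm : n ≤ m) (h : ∀ (X : Type u) [AddCommGroup X] [Module R X], ExtVanish R X M (n + 1))
    (X : Type u) [AddCommGroup X] [Module R X] : ExtVanish R X M (m + 1) := by
  induction m, hnm using Nat.le_induction generalizing X with
  | base => exact h X
  | succ m _ ih => exact ExtVanish.succ_of_forall_fst M ih X

theorem projDimLE_iff (n : ℕ) (M : Type u) [AddCommGroup M] [Module R M] :
    ProjDimLE R n M ↔ ∀ (X : Type u) [AddCommGroup X] [Module R X], ExtVanish R M X (n + 1) := by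
  induction n generalizing M with
  | zero =>
    refine ⟨fun h X _ _ => ?_, fun h => projective_of_extVanish h⟩
    have : Module.Projective R M := h
    exact extVanish_of_projective 0
  | succ n ih =>
    constructor
    · rintro (h | ⟨P, f, hP, hf, h⟩) X _ _
      · exact extVanish_of_projective _
      · exact ((ih _).1 h X).right (Submodule.injective_subtype _) hf (exact_ker_subtype _)
          (extVanish_of_projective _)
    · intro h
      refine Or.inr ⟨ModuleCat.of R (M →₀ R), freeCover R M, ?_, freeCover_surjective M,
        (ih _).2 fun X _ _ => ?_⟩
      · exact inferInstanceAs (Module.Projective R (M →₀ R))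
      · exact (extVanish_of_projective n).left_of_middle (Submodule.injective_subtype _)
          (freeCover_surjective M) (exact_ker_subtype _) (h X)

theorem injDimLE_iff (n : ℕ) (M : Type u) [AddCommGroup M] [Module R M] :
    InjDimLE R n M ↔ ∀ (X : Type u) [AddCommGroup X] [Module R X], ExtVanish R X M (n + 1) := by
  induction n generalizing M with
  | zero =>
    exact ⟨fun h X _ _ => extVanish_of_injective h 0, fun h => injective_of_extVanish h⟩
  | succ n ih =>
    constructor
    · rintro (h | ⟨I, f, hI, hf, h⟩) X _ _
      · exact extVanish_of_injective h _
      · exact ((ih _).1 h X).snd_left hf (Submodule.mkQ_surjective _) (exact_range_mkQ f)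
          (extVanish_of_injective hI _)
    · intro h
      obtain ⟨I, f, hI, hf⟩ := exists_injective_embedding (R := R) M
      refine Or.inr ⟨I, f, hI, hf, (ih _).2 fun X _ _ => ?_⟩
      exact (extVanish_of_injective hI _).snd_right hf (Submodule.mkQ_surjective _)
        (exact_range_mkQ f) (h X)

theorem sInf_natCast_le_iff {p : ℕ → Prop} (hp : ∀ n, p n → p (n + 1)) (n : ℕ) :
    sInf {a : ℕ∞ | ∃ m : ℕ, a = (m : ℕ∞) ∧ p m} ≤ n ↔ p n := by
  constructor
  · intro h
    have hlt : sInf {a : ℕ∞ | ∃ m : ℕ, a = (m : ℕ∞) ∧ p m} < ((n + 1 : ℕ) : ℕ∞) :=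
      lt_of_le_of_lt h (by exact_mod_cast Nat.lt_succ_self n)
    obtain ⟨_, ⟨m, rfl, hm⟩, hmn⟩ := sInf_lt_iff.1 hlt
    have hmn : m ≤ n := Nat.lt_succ_iff.1 (by exact_mod_cast hmn)
    induction n, hmn using Nat.le_induction with
    | base => exact hm
    | succ k hk ih =>
      exact hp _ (ih (sInf_le_of_le ⟨m, rfl, hm⟩ (by exact_mod_cast hk))
        (lt_of_le_of_lt (sInf_le ⟨m, rfl, hm⟩) (by exact_mod_cast Nat.lt_succ_of_le hk))
        (by exact_mod_cast Nat.lt_succ_of_le hk))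
  · exact fun h => sInf_le ⟨n, rfl, h⟩

theorem projDim_le_iff (n : ℕ) (M : Type u) [AddCommGroup M] [Module R M] :
    projDim R M ≤ n ↔
      ∀ (X : Type u) [AddCommGroup X] [Module R X], ExtVanish R M X (n + 1) := by
  rw [projDim, sInf_natCast_le_iff, projDimLE_iff]
  intro n h
  rw [projDimLE_iff] at h ⊢
  exact ExtVanish.succ_of_forall_snd M h

theorem injDim_le_iff (n : ℕ) (M : Type u) [AddCommGroup M] [Module R M] :
    injDim R M ≤ n ↔
      ∀ (X : Type u) [AddCommGroup X] [Module R X], ExtVanish R X M (n + 1) := by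
  rw [injDim, sInf_natCast_le_iff, injDimLE_iff]
  intro n h
  rw [injDimLE_iff] at h ⊢
  exact ExtVanish.succ_of_forall_fst M h

variable (R) in
theorem silp_le_iff (n : ℕ) : silp R ≤ n ↔
    ∀ (P : Type u) [AddCommGroup P] [Module R P], Module.Projective R P →
      ∀ (X : Type u) [AddCommGroup X] [Module R X], ExtVanish R X P (n + 1) := by
  simp only [silp, iSup_le_iff, injDim_le_iff]
  exact ⟨fun h P _ _ hP => h (ModuleCat.of R P) hP, fun h P hP => h P hP⟩

variable (R) in
theorem spli_le_iff (n : ℕ) : spli R ≤ n ↔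
    ∀ (I : Type u) [AddCommGroup I] [Module R I], Module.Injective R I →
      ∀ (X : Type u) [AddCommGroup X] [Module R X], ExtVanish R I X (n + 1) := by
  simp only [spli, iSup_le_iff, projDim_le_iff]
  exact ⟨fun h I _ _ hI => h (ModuleCat.of R I) hI, fun h I hI => h I hI⟩

/-- If every projective module has injective dimension at most `n`, then a module of finite
projective dimension has projective dimension at most `n`. -/
theorem extVanish_of_silp_of_finite {n m : ℕ}
    (hR : ∀ (P : Type u) [AddCommGroup P] [Module R P], Module.Projective R P →
      ∀ (X : Type u) [AddCommGroup X] [Module R X], ExtVanish R X P (n + 1))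
    (M : Type u) [AddCommGroup M] [Module R M]
    (hM : ∀ (X : Type u) [AddCommGroup X] [Module R X], ExtVanish R M X (m + 1))
    (X : Type u) [AddCommGroup X] [Module R X] : ExtVanish R M X (n + 1) := by
  rcases le_total m n with h | h
  · clear hR
    induction n, h using Nat.le_induction generalizing X with
    | base => exact hM X
    | succ k hk ih => exact ExtVanish.succ_of_forall_snd M ih X
  · induction m, h using Nat.le_induction with
    | base => exact hM X
    | succ m hm ih =>
      refine ih fun X _ _ => ?_
      exact (extVanish_of_le_of_forall_fst _ hm (hR (X →₀ R) inferInstance) M).snd_right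
        (Submodule.injective_subtype _)
        (freeCover_surjective X) (exact_ker_subtype _) (hM _)

end Dimensions

section CountablyGenerated

variable {R : Type*} [Ring R] {M Q : Type*} [AddCommGroup M] [Module R M]
  [AddCommGroup Q] [Module R Q]

/-- A submodule is countably generated if it is spanned by a countable set. -/
def Submodule.IsCountablyGenerated (N : Submodule R M) : Prop :=
  ∃ s : Set M, s.Countable ∧ Submodule.span R s = N

namespace Submodule.IsCountablyGenerated

theorem map {N : Submodule R M} (h : N.IsCountablyGenerated) (f : M →ₗ[R] Q) :
    (N.map f).IsCountablyGenerated := by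
  obtain ⟨s, hs, rfl⟩ := h
  exact ⟨f '' s, hs.image f, (LinearMap.map_span f s).symm⟩

theorem iSup {ι : Type*} [Countable ι] {N : ι → Submodule R M}
    (h : ∀ i, (N i).IsCountablyGenerated) : (⨆ i, N i).IsCountablyGenerated := by
  choose s hs hN using h
  exact ⟨⋃ i, s i, Set.countable_iUnion hs, by simp [Submodule.span_iUnion, hN]⟩

theorem exists_seq {N : Submodule R M} (h : N.IsCountablyGenerated) :
    ∃ r : ℕ → M, (∀ i, r i ∈ N) ∧ Submodule.span R (Set.range r) = N := by
  obtain ⟨s, hs, rfl⟩ := h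
  obtain ⟨r, hr⟩ := (hs.insert (0 : M)).exists_eq_range (Set.insert_nonempty _ _)
  have : Submodule.span R (Set.range r) = Submodule.span R s := by
    rw [← hr, Submodule.span_insert_zero]
  exact ⟨r, fun i => this ▸ Submodule.subset_span ⟨i, rfl⟩, this⟩

theorem of_map_of_inf_ker {N : Submodule R M} (f : M →ₗ[R] Q)
    (h₁ : (N.map f).IsCountablyGenerated) (h₂ : (N ⊓ LinearMap.ker f).IsCountablyGenerated) :
    N.IsCountablyGenerated := by
  obtain ⟨s, hs, hsN⟩ := h₁
  obtain ⟨t, ht, htN⟩ := h₂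
  have hlift : ∀ x : s, ∃ y ∈ N, f y = x := fun x =>
    (hsN ▸ Submodule.subset_span x.2 : (x : Q) ∈ N.map f)
  choose g hgN hg using hlift
  have := hs.to_subtype
  refine ⟨Set.range g ∪ t, (Set.countable_range g).union ht, le_antisymm ?_ fun x hx => ?_⟩
  · refine Submodule.span_le.2 (Set.union_subset ?_ fun x hx => ?_)
    · rintro _ ⟨x, rfl⟩
      exact hgN x
    · exact (htN ▸ Submodule.subset_span hx : x ∈ N ⊓ LinearMap.ker f).1
  · have hfx : f x ∈ (Submodule.span R (Set.range g)).map f := by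
      rw [LinearMap.map_span, ← Set.range_comp]
      have : Set.range (f ∘ g) = s := by
        ext y
        simp [hg]
      rw [this, hsN]
      exact ⟨x, hx, rfl⟩
    obtain ⟨y, hy, hyx⟩ := hfx
    have hyN : y ∈ N := Submodule.span_le.2 (Set.range_subset_iff.2 hgN) hy
    have hxy : x - y ∈ Submodule.span R t := by
      rw [htN]
      exact ⟨sub_mem hx hyN, by simp [hyx]⟩
    rw [← sub_add_cancel x y, Submodule.span_union]
    exact add_mem (Submodule.mem_sup_right hxy) (Submodule.mem_sup_left hy)

end Submodule.IsCountablyGenerated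

end CountablyGenerated

namespace IsLeftAleph0Noetherian

variable {R : Type u} [Ring R] (hR : IsLeftAleph0Noetherian R)

include hR

theorem isCountablyGenerated_of_le_supported_finset {X : Type*} (T : Finset X)
    {N : Submodule R (X →₀ R)} (hN : N ≤ Finsupp.supported R R (T : Set X)) :
    N.IsCountablyGenerated := by
  classical
  induction T using Finset.induction_on generalizing N with
  | empty =>
    refine ⟨∅, Set.countable_empty, ?_⟩
    simpa [eq_comm] using hN
  | insert a T _ ih =>
    refine .of_map_of_inf_ker (Finsupp.lapply a) (hR _) (ih fun x hx => ?_)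
    rw [Finsupp.mem_supported']
    intro y hy
    rcases eq_or_ne y a with rfl | hya
    · exact hx.2
    · exact (Finsupp.mem_supported' _ _).1 (hN hx.1) y (by simpa [hya] using hy)

theorem isCountablyGenerated_of_le_supported {X : Type*} {W : Set X} (hW : W.Countable)
    {N : Submodule R (X →₀ R)} (hN : N ≤ Finsupp.supported R R W) : N.IsCountablyGenerated := by
  classical
  have := hW.to_subtype
  have key : N = ⨆ T : Finset W,
      N ⊓ Finsupp.supported R R ((T.image Subtype.val : Finset X) : Set X) := by
    refine le_antisymm (fun x hx => ?_) (iSup_le fun _ => inf_le_left)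
    refine Submodule.mem_iSup_of_mem (x.support.subtype (· ∈ W)) ⟨hx, ?_⟩
    have := (Finsupp.mem_supported _ _).1 (hN hx)
    refine (Finsupp.mem_supported _ _).2 fun y hy => ?_
    simpa using ⟨by simpa using hy, this hy⟩
  rw [key]
  exact .iSup fun T => hR.isCountablyGenerated_of_le_supported_finset _ inf_le_right

theorem isCountablyGenerated_of_countable {X : Type*} [Countable X]
    (N : Submodule R (X →₀ R)) : N.IsCountablyGenerated :=
  hR.isCountablyGenerated_of_le_supported (Set.to_countable Set.univ) (by simp)

end IsLeftAleph0Noetherian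

theorem AddMonoidHom.exists_comp_eq_of_ker_le {G G' : Type*} [AddCommGroup G] [AddCommGroup G']
    (f : G →+ G') (L : G →+ AddCircle (1 : ℚ)) (h : ∀ x, f x = 0 → L x = 0) :
    ∃ η : G' →+ AddCircle (1 : ℚ), ∀ x, η (f x) = L x := by
  obtain ⟨η, hη⟩ := (Module.Baer.of_divisible (AddCircle (1 : ℚ))).extension_property_addMonoidHom
    (QuotientAddGroup.kerLift f) (QuotientAddGroup.kerLift_injective f)
    (QuotientAddGroup.lift f.ker L h)
  exact ⟨η, fun x => DFunLike.congr_fun hη (x : G ⧸ f.ker)⟩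

section TwistedDual

variable {R : Type u} [Ring R]

/-- The group of characters of a left `R`-module `Y`, with the left action of `R` obtained by
twisting along an anti-endomorphism `s` of `R`. -/
def TwistedDual (_ : R →+* Rᵐᵒᵖ) (Y : Type u) [AddCommGroup Y] : Type u :=
  Y →+ AddCircle (1 : ℚ)

namespace TwistedDual

variable {s : R →+* Rᵐᵒᵖ} {Y : Type u} [AddCommGroup Y]

instance : AddCommGroup (TwistedDual s Y) := inferInstanceAs (AddCommGroup (Y →+ AddCircle (1 : ℚ)))

instance : FunLike (TwistedDual s Y) Y (AddCircle (1 : ℚ)) :=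
  inferInstanceAs (FunLike (Y →+ AddCircle (1 : ℚ)) Y (AddCircle (1 : ℚ)))

instance : AddMonoidHomClass (TwistedDual s Y) Y (AddCircle (1 : ℚ)) :=
  inferInstanceAs (AddMonoidHomClass (Y →+ AddCircle (1 : ℚ)) Y (AddCircle (1 : ℚ)))

/-- A character as an element of the twisted dual. -/
def mk (f : Y →+ AddCircle (1 : ℚ)) : TwistedDual s Y := f

@[simp] theorem mk_apply (f : Y →+ AddCircle (1 : ℚ)) (y : Y) : (mk f : TwistedDual s Y) y = f y :=
  rfl

@[simp] theorem add_apply (f g : TwistedDual s Y) (y : Y) : (f + g) y = f y + g y := rfl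

@[simp] theorem zero_apply (y : Y) : (0 : TwistedDual s Y) y = 0 := rfl

@[ext] theorem ext {f g : TwistedDual s Y} (h : ∀ y, f y = g y) : f = g := DFunLike.ext _ _ h

variable [Module R Y]

instance : SMul R (TwistedDual s Y) :=
  ⟨fun h f => mk ((f : Y →+ AddCircle (1 : ℚ)).comp (DistribSMul.toAddMonoidHom Y (s h).unop))⟩

@[simp] theorem smul_apply (h : R) (f : TwistedDual s Y) (y : Y) :
    (h • f) y = f ((s h).unop • y) := rfl

instance : Module R (TwistedDual s Y) where
  one_smul f := by ext y; simp
  mul_smul a b f := by ext y; simp [mul_smul]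
  smul_zero a := by ext y; simp
  smul_add a f g := by ext y; simp
  add_smul a b f := by ext y; simp [add_smul]
  zero_smul f := by ext y; simp

/-- Evaluation at a point, as an additive map. -/
def eval (y : Y) : TwistedDual s Y →+ AddCircle (1 : ℚ) where
  toFun f := f y
  map_zero' := rfl
  map_add' _ _ := rfl

omit [Module R Y] in
@[simp] theorem eval_apply (y : Y) (f : TwistedDual s Y) : eval y f = f y := rfl

end TwistedDual

/-- If maps from a countably generated submodule of a free module to `ℕ →₀ R` extend, then
finitely many linear conditions suffice to extend a functional on a given finite set. -/
theorem exists_finite_conditions {X P : Type*} [AddCommGroup P] [Module R P]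
    (d : (X →₀ R) →ₗ[R] P) (hcg : (LinearMap.ker d).IsCountablyGenerated)
    (H₁ : ∀ g : LinearMap.ker d →ₗ[R] (ℕ →₀ R),
      ∃ g' : (X →₀ R) →ₗ[R] (ℕ →₀ R), g' ∘ₗ (LinearMap.ker d).subtype = g)
    (H₂ : ∀ φ : (X →₀ R) →ₗ[R] R, (∀ x ∈ LinearMap.ker d, φ x = 0) →
      ∃ ψ : P →ₗ[R] R, ψ ∘ₗ d = φ) (T : Finset X) :
    ∃ (j : ℕ) (r : Fin j → (X →₀ R)), (∀ i, d (r i) = 0) ∧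
      ∀ φ : (X →₀ R) →ₗ[R] R, (∀ i, φ (r i) = 0) →
        ∃ ψ : P →ₗ[R] R, ∀ x ∈ T, φ (Finsupp.single x 1) = ψ (d (Finsupp.single x 1)) := by
  classical
  obtain ⟨r, hr, hspan⟩ := hcg.exists_seq
  by_contra! hcon
  choose φ hφ hψ using fun j => hcon j (fun i : Fin j => r i) (fun i => hr i)
  have hfin : ∀ n : LinearMap.ker d, (Function.support fun j => φ j n).Finite := by
    rintro ⟨n, hn⟩
    change (Function.support fun j => φ j n).Finite
    rw [← hspan] at hn
    induction hn using Submodule.span_induction with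
    | mem x hx =>
      obtain ⟨i, rfl⟩ := hx
      refine (Set.finite_Iic i).subset fun j hj => ?_
      by_contra hji
      exact hj (hφ j ⟨i, not_le.1 hji⟩)
    | zero => simp
    | add x y _ _ hx hy =>
      refine (hx.union hy).subset ((Function.support_add _ _).trans' ?_)
      simp
    | smul a x _ hx =>
      refine hx.subset fun j hj => ?_
      contrapose! hj
      simp_all
  let g : LinearMap.ker d →ₗ[R] (ℕ →₀ R) :=
    { toFun := fun n => Finsupp.ofSupportFinite _ (hfin n)
      map_add' := fun a b => by ext j; exact map_add (φ j) _ _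
      map_smul' := fun c a => by ext j; exact map_smul (φ j) _ _ }
  obtain ⟨g', hg'⟩ := H₁ g
  obtain ⟨i, hi⟩ := (T.biUnion fun x => (g' (Finsupp.single x 1)).support).exists_notMem
  obtain ⟨ψ, hψi⟩ := H₂ (Finsupp.lapply i ∘ₗ g' - φ i) fun x hx => by
    have := DFunLike.congr_fun (LinearMap.congr_fun hg' ⟨x, hx⟩) i
    have h2 : g ⟨x, hx⟩ i = φ i x := rfl
    simpa [sub_eq_zero] using this.trans h2
  obtain ⟨x, hxT, hx⟩ := hψ i (-ψ)
  have hgx : g' (Finsupp.single x 1) i = 0 := by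
    by_contra h
    exact hi (Finset.mem_biUnion.2 ⟨x, hxT, by simpa using h⟩)
  have := LinearMap.congr_fun hψi (Finsupp.single x 1)
  simp [hgx] at this
  simp [this] at hx

section DoubleDual

variable {t t' : R →+* Rᵐᵒᵖ} {A : Type u} [AddCommGroup A] [Module R A]

/-- The balanced pairing `(r, ξ) ↦ ∑ y, t'(r_y) • ξ` between a free module and a module. -/
noncomputable def twistedPair (t' : R →+* Rᵐᵒᵖ) (A : Type u) [AddCommGroup A] [Module R A]
    (Y : Type*) : (Y →₀ R) →+ A →+ (Y →₀ A) :=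
  Finsupp.liftAddHom fun y => (AddMonoidHom.compHom (Finsupp.singleAddHom y)).comp
    ((smulAddHom R A).comp (MulOpposite.opAddEquiv.symm.toAddMonoidHom.comp t'.toAddMonoidHom))

@[simp] theorem twistedPair_single {Y : Type*} (y : Y) (c : R) (ξ : A) :
    twistedPair t' A Y (Finsupp.single y c) ξ = Finsupp.single y ((t' c).unop • ξ) := by
  simp [twistedPair]

/-- Evaluation of a family of characters on a linear functional. -/
noncomputable def evalFunctional {Y : Type*} (ψ : (Y →₀ R) →ₗ[R] R) :
    (Y →₀ TwistedDual t R) →+ AddCircle (1 : ℚ) :=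
  Finsupp.liftAddHom fun y => TwistedDual.eval (ψ (Finsupp.single y 1))

@[simp] theorem evalFunctional_single {Y : Type*} (ψ : (Y →₀ R) →ₗ[R] R) (y : Y)
    (ξ : TwistedDual t R) :
    evalFunctional ψ (Finsupp.single y ξ) = ξ (ψ (Finsupp.single y 1)) := by
  exact Finsupp.liftAddHom_apply_single _ _ _

theorem evalFunctional_add {Y : Type*} (φ ψ : (Y →₀ R) →ₗ[R] R) (ω : Y →₀ TwistedDual t R) :
    evalFunctional (φ + ψ) ω = evalFunctional φ ω + evalFunctional ψ ω := by
  induction ω using Finsupp.induction_linear with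
  | zero => simp
  | add f g hf hg => rw [map_add, hf, hg, map_add, map_add]; abel
  | single y ξ => simp

theorem evalFunctional_twistedPair (ht : ∀ c, (t (t' c).unop).unop = c) {Y : Type*}
    (ψ : (Y →₀ R) →ₗ[R] R) (q : Y →₀ R) (ξ : TwistedDual t R) :
    evalFunctional ψ (twistedPair t' _ Y q ξ) = ξ (ψ q) := by
  induction q using Finsupp.induction_linear with
  | zero => simp
  | add f g hf hg => simp [hf, hg]
  | single y c =>
    simp only [twistedPair_single, evalFunctional_single, TwistedDual.smul_apply, ht]
    rw [← map_smul]
    simp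

theorem exists_extension_doubleDual (ht : ∀ c, (t (t' c).unop).unop = c) {X Y : Type*}
    (d : (X →₀ R) →ₗ[R] (Y →₀ R)) (hcg : (LinearMap.ker d).IsCountablyGenerated)
    (H₁ : ∀ g : LinearMap.ker d →ₗ[R] (ℕ →₀ R),
      ∃ g' : (X →₀ R) →ₗ[R] (ℕ →₀ R), g' ∘ₗ (LinearMap.ker d).subtype = g)
    (H₂ : ∀ φ : (X →₀ R) →ₗ[R] R, (∀ x ∈ LinearMap.ker d, φ x = 0) →
      ∃ ψ : (Y →₀ R) →ₗ[R] R, ψ ∘ₗ d = φ)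
    (Φ : (X →₀ R) →ₗ[R] TwistedDual t' (TwistedDual t R))
    (hΦ : ∀ x ∈ LinearMap.ker d, Φ x = 0) :
    ∃ Ψ : (Y →₀ R) →ₗ[R] TwistedDual t' (TwistedDual t R), Ψ ∘ₗ d = Φ := by
  classical
  let δ : (X →₀ TwistedDual t R) →+ (Y →₀ TwistedDual t R) :=
    Finsupp.liftAddHom fun x => twistedPair t' _ Y (d (Finsupp.single x 1))
  let Φ' : (X →₀ TwistedDual t R) →+ AddCircle (1 : ℚ) :=
    Finsupp.liftAddHom fun x => (Φ (Finsupp.single x 1) : _ →+ AddCircle (1 : ℚ))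
  have hδ : ∀ x ξ, δ (Finsupp.single x ξ) = twistedPair t' _ Y (d (Finsupp.single x 1)) ξ := by
    simp [δ]
  have hΦ's : ∀ x ξ, Φ' (Finsupp.single x ξ) = Φ (Finsupp.single x 1) ξ := fun x ξ => by
    exact Finsupp.liftAddHom_apply_single _ _ _
  have hΦ' : ∀ (r : X →₀ R) η, Φ' (twistedPair t' _ X r η) = Φ r η := fun r η => by
    induction r using Finsupp.induction_linear with
    | zero => simp
    | add f g hf hg => simp [hf, hg]
    | single x c =>
      rw [twistedPair_single, hΦ's, ← TwistedDual.smul_apply, ← map_smul]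
      simp
  have hker : ∀ ω, δ ω = 0 → Φ' ω = 0 := fun ω hω => by
    obtain ⟨j, r, hr, hφ⟩ := exists_finite_conditions d hcg H₁ H₂ ω.support
    let ev : ((X →₀ R) →ₗ[R] R) →+ (Fin j → R) :=
      { toFun := fun φ i => φ (r i), map_zero' := rfl, map_add' := fun _ _ => rfl }
    let L : ((X →₀ R) →ₗ[R] R) →+ AddCircle (1 : ℚ) :=
      AddMonoidHom.mk' (fun φ => evalFunctional φ ω) fun φ ψ => evalFunctional_add φ ψ ω
    obtain ⟨η, hη⟩ := AddMonoidHom.exists_comp_eq_of_ker_le ev L fun φ h0 => by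
      obtain ⟨ψ, hψ⟩ := hφ φ fun i => congrFun h0 i
      have h1 : evalFunctional φ ω = evalFunctional ψ (δ ω) := by
        conv_rhs => rw [← Finsupp.sum_single ω, Finsupp.sum, map_sum, map_sum]
        conv_lhs => rw [← Finsupp.sum_single ω, Finsupp.sum, map_sum]
        refine Finset.sum_congr rfl fun x hx => ?_
        rw [hδ, evalFunctional_twistedPair ht, evalFunctional_single, hψ x hx]
      change evalFunctional φ ω = 0
      rw [h1, hω, map_zero]
    let ηi : Fin j → TwistedDual t R := fun i =>
      TwistedDual.mk (η.comp (AddMonoidHom.single (fun _ => R) i))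
    have key : ω = ∑ i, twistedPair t' _ X (r i) (ηi i) := by
      have hpair : ∀ φ, evalFunctional φ ω =
          evalFunctional φ (∑ i, twistedPair t' _ X (r i) (ηi i)) := fun φ => by
        rw [map_sum]
        simp only [evalFunctional_twistedPair ht]
        change L φ = _
        rw [← hη φ, ← Finset.univ_sum_single (ev φ), map_sum]
        rfl
      ext x z
      have h2 : ∀ θ : X →₀ TwistedDual t R,
          evalFunctional ((LinearMap.toSpanSingleton R R z) ∘ₗ Finsupp.lapply x) θ = θ x z :=
        fun θ => by
          induction θ using Finsupp.induction_linear with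
          | zero => simp
          | add f g hf hg => simp [hf, hg]
          | single y ξ =>
            rcases eq_or_ne y x with rfl | h
            · simp
            · simp [h]
      rw [← h2, ← h2, hpair]
    rw [key, map_sum]
    simp [hΦ', hΦ _ (LinearMap.mem_ker.2 (hr _))]
  obtain ⟨Ψ', hΨ'⟩ := AddMonoidHom.exists_comp_eq_of_ker_le δ Φ' hker
  let Ψ : (Y →₀ R) →ₗ[R] TwistedDual t' (TwistedDual t R) :=
    Finsupp.linearCombination R fun y => TwistedDual.mk (Ψ'.comp (Finsupp.singleAddHom y))
  have hΨ : ∀ q ξ, Ψ q ξ = Ψ' (twistedPair t' _ Y q ξ) := fun q ξ => by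
    induction q using Finsupp.induction_linear with
    | zero => simp
    | add f g hf hg => simp [hf, hg]
    | single y c => simp [Ψ]
  refine ⟨Ψ, Finsupp.lhom_ext' fun x => LinearMap.ext_ring ?_⟩
  ext ξ
  simp only [LinearMap.comp_apply, Finsupp.lsingle_apply, hΨ, ← hδ, hΨ', hΦ's]

end DoubleDual

end TwistedDual

section TwistedDualExt

variable {R : Type u} [Ring R] {t t' : R →+* Rᵐᵒᵖ}

theorem extVanish_one_doubleDual (hR : IsLeftAleph0Noetherian R)
    (ht : ∀ c, (t (t' c).unop).unop = c)
    {K M : Type u} [AddCommGroup K] [Module R K] [AddCommGroup M] [Module R M]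
    {q : (ℕ →₀ R) →ₗ[R] K} {i : K →ₗ[R] (ℕ →₀ R)} {f : (ℕ →₀ R) →ₗ[R] M}
    (hq : Function.Surjective q) (hi : Function.Injective i) (hf : Function.Surjective f)
    (hex : Function.Exact i f) (h₁ : ExtVanish R M R 1) (h₂ : ExtVanish R M (ℕ →₀ R) 2) :
    ExtVanish R M (TwistedDual t' (TwistedDual t R)) 1 := by
  refine extVanish_one_of_extension hi hf hex (extVanish_of_projective 0) fun g => ?_
  have hker : LinearMap.ker (i ∘ₗ q) = LinearMap.ker q :=
    LinearMap.ker_comp_of_ker_eq_bot _ (LinearMap.ker_eq_bot.2 hi)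
  have hK : ExtVanish R K (ℕ →₀ R) 1 :=
    (extVanish_of_projective 0).left_of_middle hi hf hex h₂
  have H₁ : ∀ g : LinearMap.ker q →ₗ[R] (ℕ →₀ R),
      ∃ g' : (ℕ →₀ R) →ₗ[R] (ℕ →₀ R), g' ∘ₗ (LinearMap.ker q).subtype = g :=
    hK.exists_extension (Submodule.injective_subtype _) hq (exact_ker_subtype q)
  have H₂ : ∀ φ : (ℕ →₀ R) →ₗ[R] R, (∀ x ∈ LinearMap.ker q, φ x = 0) →
      ∃ ψ : (ℕ →₀ R) →ₗ[R] R, ψ ∘ₗ i ∘ₗ q = φ := by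
    intro φ hφ
    obtain ⟨ψ, hψ⟩ := h₁.exists_extension hi hf hex ((LinearMap.ker q).liftQ φ hφ ∘ₗ
      (q.quotKerEquivOfSurjective hq).symm.toLinearMap)
    refine ⟨ψ, ?_⟩
    rw [← LinearMap.comp_assoc, hψ]
    ext j
    have : (q.quotKerEquivOfSurjective hq).symm (q (Finsupp.single j 1)) =
        Submodule.Quotient.mk (Finsupp.single j 1) := by
      rw [LinearEquiv.symm_apply_eq]; rfl
    exact (congrArg ((LinearMap.ker q).liftQ φ hφ) this).trans (Submodule.liftQ_apply _ _ _)
  rw [← hker] at H₁ H₂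
  obtain ⟨Ψ, hΨ⟩ := exists_extension_doubleDual ht (i ∘ₗ q)
    (hR.isCountablyGenerated_of_countable _) H₁ H₂ (g ∘ₗ q) fun x hx => by
      rw [hker] at hx
      simp [LinearMap.mem_ker.1 hx]
  refine ⟨Ψ, LinearMap.ext fun x => ?_⟩
  obtain ⟨x, rfl⟩ := hq x
  exact LinearMap.congr_fun hΨ x

theorem Submodule.IsCountablyGenerated.exists_surjective {M : Type*} [AddCommGroup M] [Module R M]
    {N : Submodule R M} (h : N.IsCountablyGenerated) :
    ∃ q : (ℕ →₀ R) →ₗ[R] N, Function.Surjective q := by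
  obtain ⟨r, hr, hspan⟩ := h.exists_seq
  let q : (ℕ →₀ R) →ₗ[R] N := Finsupp.linearCombination R fun i => ⟨r i, hr i⟩
  have hq' : N.subtype ∘ₗ q = Finsupp.linearCombination R r := by
    ext; simp [q]
  refine ⟨q, ?_⟩
  rintro ⟨x, hx⟩
  rw [← hspan, ← Finsupp.range_linearCombination] at hx
  obtain ⟨c, rfl⟩ := hx
  exact ⟨c, Subtype.ext (LinearMap.congr_fun hq' c)⟩

theorem extVanish_doubleDual (hR : IsLeftAleph0Noetherian R)
    (ht : ∀ c, (t (t' c).unop).unop = c) (n : ℕ)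
    {M : Type u} [AddCommGroup M] [Module R M] {f : (ℕ →₀ R) →ₗ[R] M} (hf : Function.Surjective f)
    (h : ∀ j, ExtVanish R M R (n + j + 1) ∧ ExtVanish R M (ℕ →₀ R) (n + j + 1)) :
    ExtVanish R M (TwistedDual t' (TwistedDual t R)) (n + 1) := by
  obtain ⟨q, hq⟩ :=
    (hR.isCountablyGenerated_of_countable (LinearMap.ker f)).exists_surjective
  induction n generalizing M with
  | zero =>
    exact extVanish_one_doubleDual (K := LinearMap.ker f) hR ht hq (Submodule.injective_subtype _)
      hf (exact_ker_subtype f) (h 0).1 (h 1).2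
  | succ n ih =>
    obtain ⟨q', hq'⟩ :=
      (hR.isCountablyGenerated_of_countable (LinearMap.ker q)).exists_surjective
    have hK : ∀ (X : Type u) [AddCommGroup X] [Module R X] (j : ℕ),
        ExtVanish R M X (n + 1 + j + 1) → ExtVanish R (LinearMap.ker f) X (n + j + 1) :=
      fun X _ _ j hX => (extVanish_of_projective _).left_of_middle (A := LinearMap.ker f)
        (Submodule.injective_subtype _) hf (exact_ker_subtype f)
        (by rwa [show n + 1 + j = n + j + 1 by omega] at hX)
    exact (ih hq (fun j => ⟨hK _ j (h j).1, hK _ j (h j).2⟩) q' hq').right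
      (Submodule.injective_subtype _) hf (exact_ker_subtype f) (extVanish_of_projective _)

namespace TwistedDual

theorem injective_of_free (ht : ∀ c, (t (t' c).unop).unop = c)
    (ht' : ∀ c, (t' (t c).unop).unop = c) (X : Type u) :
    Module.Injective R (TwistedDual t' (X →₀ R)) := by
  refine ⟨fun M N _ _ _ _ f hf g => ?_⟩
  choose χ hχ using fun x : X =>
    (Module.Baer.of_divisible (AddCircle (1 : ℚ))).extension_property_addMonoidHom
      f.toAddMonoidHom hf ((eval (Finsupp.single x 1)).comp g.toAddMonoidHom)
  have hχ' : ∀ x m, χ x (f m) = g m (Finsupp.single x 1) := fun x m => DFunLike.congr_fun (hχ x) m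
  let act : N →+ R →+ N := ((smulAddHom R N).comp
    (MulOpposite.opAddEquiv.symm.toAddMonoidHom.comp t.toAddMonoidHom)).flip
  have hact : ∀ n c, act n c = (t c).unop • n := fun _ _ => rfl
  let h : N → TwistedDual t' (X →₀ R) := fun n =>
    mk (Finsupp.liftAddHom fun x => (χ x).comp (act n))
  have hh : ∀ n x c, h n (Finsupp.single x c) = χ x ((t c).unop • n) := fun n x c =>
    Finsupp.liftAddHom_apply_single _ _ _
  have hext : ∀ a b : TwistedDual t' (X →₀ R),
      (∀ x c, a (Finsupp.single x c) = b (Finsupp.single x c)) → a = b := fun a b hab => by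
    ext q
    induction q using Finsupp.induction_linear with
    | zero => simp
    | add f g hf hg => rw [map_add, map_add, hf, hg]
    | single x c => exact hab x c
  refine ⟨{ toFun := h, map_add' := fun m n => hext _ _ fun x c => ?_,
            map_smul' := fun a n => hext _ _ fun x c => ?_ }, fun m => hext _ _ fun x c => ?_⟩
  · simp [hh]
  · rw [hh, RingHom.id_apply, smul_apply, Finsupp.smul_single, hh]
    simp [mul_smul, ht]
  · change h (f m) _ = _
    rw [hh, ← map_smul, hχ', map_smul, smul_apply, ht']
    simp

/-- The map of twisted duals induced by a linear map. -/
def map (s : R →+* Rᵐᵒᵖ) {Y Y' : Type u} [AddCommGroup Y] [Module R Y] [AddCommGroup Y']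
    [Module R Y'] (f : Y →ₗ[R] Y') : TwistedDual s Y' →ₗ[R] TwistedDual s Y where
  toFun φ := mk ((φ : Y' →+ AddCircle (1 : ℚ)).comp f.toAddMonoidHom)
  map_add' _ _ := rfl
  map_smul' c φ := by ext y; exact congrArg φ (map_smul f _ y).symm

@[simp] theorem map_apply (s : R →+* Rᵐᵒᵖ) {Y Y' : Type u} [AddCommGroup Y] [Module R Y]
    [AddCommGroup Y'] [Module R Y'] (f : Y →ₗ[R] Y') (φ : TwistedDual s Y') (y : Y) :
    map s f φ y = φ (f y) := rfl

theorem extVanish_dual_ker (ht : ∀ c, (t (t' c).unop).unop = c)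
    (ht' : ∀ c, (t' (t c).unop).unop = c) {M Y : Type u} [AddCommGroup M] [Module R M]
    [AddCommGroup Y] [Module R Y] {n : ℕ} (h : ExtVanish R M (TwistedDual t' Y) (n + 2)) :
    ExtVanish R M (TwistedDual t' (LinearMap.ker (freeCover R Y))) (n + 1) := by
  let i := map t' (freeCover R Y)
  let p := map (Y := LinearMap.ker (freeCover R Y)) t' (LinearMap.ker (freeCover R Y)).subtype
  refine (extVanish_of_injective (injective_of_free ht ht' Y) n).snd_right (i := i) (f := p)
    ?_ ?_ ?_ h
  · intro a b hab
    ext y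
    obtain ⟨q, rfl⟩ := freeCover_surjective (R := R) Y y
    exact DFunLike.congr_fun hab q
  · intro φ
    obtain ⟨ψ, hψ⟩ :=
      (Module.Baer.of_divisible (AddCircle (1 : ℚ))).extension_property_addMonoidHom
        (LinearMap.ker (freeCover R Y)).subtype.toAddMonoidHom (Submodule.injective_subtype _) φ
    exact ⟨mk ψ, hψ⟩
  · intro φ
    constructor
    · intro hφ
      obtain ⟨η, hη⟩ := AddMonoidHom.exists_comp_eq_of_ker_le (freeCover R Y).toAddMonoidHom
        (φ : (Y →₀ R) →+ AddCircle (1 : ℚ)) fun x hx => DFunLike.congr_fun hφ ⟨x, hx⟩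
      exact ⟨mk η, ext hη⟩
    · rintro ⟨ψ, rfl⟩
      ext y
      exact (congrArg ψ y.2).trans (map_zero ψ)

end TwistedDual

/-- The iterated kernels of the tautological free covers of a module. -/
noncomputable def iteratedSyzygy (M : ModuleCat.{u} R) : ℕ → ModuleCat.{u} R
  | 0 => M
  | n + 1 => ModuleCat.of R (LinearMap.ker (freeCover R (iteratedSyzygy M n)))

theorem extVanish_dual_iteratedSyzygy (ht : ∀ c, (t (t' c).unop).unop = c)
    (ht' : ∀ c, (t' (t c).unop).unop = c) {M : Type u} [AddCommGroup M] [Module R M]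
    (Y : ModuleCat.{u} R) (i j : ℕ) (h : ExtVanish R M (TwistedDual t' Y) (i + j + 1)) :
    ExtVanish R M (TwistedDual t' (iteratedSyzygy Y i)) (j + 1) := by
  induction i generalizing j with
  | zero => rwa [Nat.zero_add] at h
  | succ i ih =>
    exact TwistedDual.extVanish_dual_ker ht ht'
      (ih (j + 1) (by rwa [show i + (j + 1) = i + 1 + j by omega]))

/-- If `Ext¹(R / I, D) = 0` for every left ideal `I`, where `D` is the twisted dual of the
quotient of a free module by a submodule `N`, then every element of `N` is fixed by an
endomorphism with image in `N`. -/
theorem exists_local_splitting (ht' : ∀ c, (t' (t c).unop).unop = c)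
    {X Y : Type u} [AddCommGroup Y] [Module R Y]
    (f : (X →₀ R) →ₗ[R] Y) (hf : Function.Surjective f)
    (h : ∀ I : Submodule R R, ExtVanish R (R ⧸ I) (TwistedDual t' Y) 1)
    (r : X →₀ R) (hr : f r = 0) :
    ∃ θ : (X →₀ R) →ₗ[R] (X →₀ R), (∀ q, f (θ q) = 0) ∧ θ r = r := by
  classical
  let S : AddSubgroup (X →₀ R) :=
    { carrier := {q | ∃ u : X → (X →₀ R), (∀ x, f (u x) = 0) ∧ q = ∑ x ∈ r.support, r x • u x}
      add_mem' := by
        rintro _ _ ⟨u, hu, rfl⟩ ⟨v, hv, rfl⟩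
        exact ⟨u + v, fun x => by simp [hu, hv], by simp [Finset.sum_add_distrib]⟩
      zero_mem' := ⟨0, fun x => by simp, by simp⟩
      neg_mem' := by
        rintro _ ⟨u, hu, rfl⟩
        exact ⟨-u, fun x => by simp [hu], by simp⟩ }
  suffices hmem : r ∈ S by
    obtain ⟨u, hu, hur⟩ := hmem
    refine ⟨Finsupp.linearCombination R u, fun q => ?_, Eq.trans ?_ hur.symm⟩
    · simp [Finsupp.linearCombination_apply, Finsupp.sum, hu]
    · simp [Finsupp.linearCombination_apply, Finsupp.sum]
  by_contra hmem
  have hne : (r : (X →₀ R) ⧸ S) ≠ 0 := by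
    rwa [Ne, QuotientAddGroup.eq_zero_iff]
  obtain ⟨c, hc⟩ := CharacterModule.exists_character_apply_ne_zero_of_ne_zero hne
  let χ : (X →₀ R) →+ AddCircle (1 : ℚ) :=
    (c : _ →+ AddCircle (1 : ℚ)).comp (QuotientAddGroup.mk' S)
  have hχr : χ r ≠ 0 := hc
  have hχ : ∀ x ∈ r.support, ∀ u ∈ LinearMap.ker f, χ (r x • u) = 0 := fun x hx u hu => by
    have h1 : ((r x • u : X →₀ R) : (X →₀ R) ⧸ S) = 0 := by
      rw [QuotientAddGroup.eq_zero_iff]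
      refine ⟨Pi.single x u, fun y => ?_, ?_⟩
      · rcases eq_or_ne y x with rfl | hyx
        · simpa using hu
        · simp [hyx]
      · rw [Finset.sum_eq_single x]
        · simp
        · intro y _ hyx
          simp [hyx]
        · exact fun h => absurd hx h
    exact (congrArg c h1).trans (map_zero c)
  let I : Submodule R R :=
    { carrier := {c | ∀ u ∈ LinearMap.ker f, χ ((t' c).unop • u) = 0}
      add_mem' := fun {a b} ha hb u hu => by simp [add_smul, ha u hu, hb u hu]
      zero_mem' := fun u hu => by simp
      smul_mem' := fun a c hc u hu => by
        simpa [mul_smul] using hc _ (Submodule.smul_mem _ _ hu) }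
  choose l hl using hf
  have hwd : ∀ c ∈ I, ∀ q q', f q = f q' → χ ((t' c).unop • q) = χ ((t' c).unop • q') :=
    fun c hc q q' hqq => by
      rw [← sub_eq_zero, ← map_sub, ← smul_sub]
      exact hc _ (by simp [hqq])
  let F : I →ₗ[R] TwistedDual t' Y :=
    { toFun := fun c => TwistedDual.mk (AddMonoidHom.mk' (fun y => χ ((t' c).unop • l y))
        fun y z => by
          rw [← map_add, ← smul_add]
          exact hwd c c.2 _ _ (by simp [hl]))
      map_add' := fun a b => by ext y; simp [add_smul]
      map_smul' := fun a b => by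
        ext y
        simp only [TwistedDual.mk_apply, RingHom.id_apply, TwistedDual.smul_apply,
          AddMonoidHom.mk'_apply, Submodule.coe_smul, smul_eq_mul, map_mul, MulOpposite.unop_mul,
          mul_smul]
        exact hwd b b.2 _ _ (by simp [hl]) }
  obtain ⟨G, hG⟩ := (h I).exists_extension (Submodule.injective_subtype I)
    (Submodule.mkQ_surjective I) (by intro x; simp) F
  have hGc : ∀ a, ∀ ha : (t a).unop ∈ I, ∀ q, χ (a • q) = G 1 (a • f q) := fun a ha q => by
    have h1 : G (t a).unop = F ⟨_, ha⟩ := LinearMap.congr_fun hG ⟨_, ha⟩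
    have h2 : G (t a).unop = (t a).unop • G 1 := by rw [← map_smul]; simp
    have h3 := DFunLike.congr_fun (h2.symm.trans h1) (f q)
    simp only [TwistedDual.smul_apply, ht'] at h3
    rw [h3]
    change _ = χ ((t' (t a).unop).unop • l (f q))
    rw [hwd _ ha _ q (hl _), ht']
  apply hχr
  have h4 : χ r = G 1 (f r) := by
    conv_lhs => rw [← Finsupp.sum_single r, Finsupp.sum, map_sum]
    conv_rhs => rw [← Finsupp.sum_single r, Finsupp.sum, map_sum, map_sum]
    refine Finset.sum_congr rfl fun x hx => ?_
    have h5 : (t (r x)).unop ∈ I := fun u hu => by rw [ht']; exact hχ x hx u hu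
    rw [show Finsupp.single x (r x) = r x • Finsupp.single x (1 : R) by simp, hGc _ h5, map_smul f]
  rw [h4, hr, map_zero]

end TwistedDualExt

section LocalSplitting

/-- A set-theoretic closure argument: a countable set can be enlarged to a countable set that is
closed under countably many finitary operations. -/
theorem exists_countable_closure {Ω : Type*} (c : Finset Ω → Set Ω) (hc : ∀ T, (c T).Countable)
    {W₀ : Set Ω} (hW₀ : W₀.Countable) :
    ∃ W : Set Ω, W₀ ⊆ W ∧ W.Countable ∧ ∀ T : Finset Ω, (T : Set Ω) ⊆ W → c T ⊆ W := by
  classical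
  let step : Set Ω → Set Ω := fun W => W ∪ ⋃ T : Finset W, c (T.image Subtype.val)
  have hstep : ∀ n, (step^[n] W₀).Countable := fun n => by
    induction n with
    | zero => exact hW₀
    | succ n ih =>
      rw [Function.iterate_succ_apply']
      have := ih.to_subtype
      exact ih.union (Set.countable_iUnion fun T => hc _)
  have hmono : Monotone fun n => step^[n] W₀ := monotone_nat_of_le_succ fun n => by
    rw [Function.iterate_succ_apply']
    exact Set.subset_union_left
  refine ⟨⋃ n, step^[n] W₀, Set.subset_iUnion (fun n => step^[n] W₀) 0,
    Set.countable_iUnion hstep, fun T hT => ?_⟩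
  have hn : ∃ n, (T : Set Ω) ⊆ step^[n] W₀ := by
    induction T using Finset.induction_on with
    | empty => exact ⟨0, by simp⟩
    | insert a T _ ih =>
      rw [Finset.coe_insert, Set.insert_subset_iff] at hT
      obtain ⟨n, hn⟩ := ih hT.2
      obtain ⟨m, hm⟩ := Set.mem_iUnion.1 hT.1
      refine ⟨max m n, ?_⟩
      rw [Finset.coe_insert, Set.insert_subset_iff]
      exact ⟨hmono (le_max_left m n) hm, hn.trans (hmono (le_max_right m n))⟩
  obtain ⟨n, hn⟩ := hn
  refine Set.Subset.trans ?_ (Set.subset_iUnion (fun n => step^[n] W₀) (n + 1))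
  simp only [Function.iterate_succ_apply']
  refine Set.Subset.trans ?_ Set.subset_union_right
  refine Set.Subset.trans ?_ (Set.subset_iUnion _ (T.subtype (· ∈ step^[n] W₀)))
  have : (T.subtype (· ∈ step^[n] W₀)).image Subtype.val = T := by
    ext x
    simpa using fun hx => hn hx
  rw [this]

variable {R : Type u} [Ring R] {Q : Type u} [AddCommGroup Q] [Module R Q]

theorem Submodule.exists_linearMap_fix_finite {N : Submodule R Q}
    (h : ∀ r ∈ N, ∃ θ : Q →ₗ[R] N, (θ r : Q) = r) (r : ℕ → Q) (hr : ∀ i, r i ∈ N) (j : ℕ) :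
    ∃ θ : Q →ₗ[R] N, ∀ i < j, (θ (r i) : Q) = r i := by
  induction j with
  | zero => exact ⟨0, by simp⟩
  | succ j ih =>
    obtain ⟨θ, hθ⟩ := ih
    obtain ⟨θ', hθ'⟩ := h (r j - θ (r j)) (sub_mem (hr j) (θ (r j)).2)
    refine ⟨θ + θ' ∘ₗ (LinearMap.id - N.subtype ∘ₗ θ), fun i hi => ?_⟩
    rcases Nat.lt_succ_iff_lt_or_eq.1 hi with hi | rfl
    · simp [hθ i hi]
    · change (θ (r i) : Q) + (θ' (r i - θ (r i)) : Q) = _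
      rw [hθ', add_sub_cancel]

/-- A countably generated submodule of a projective module all of whose elements are fixed by
maps into the submodule is projective. -/
theorem Submodule.IsCountablyGenerated.projective_of_local_splitting [Module.Projective R Q]
    {N : Submodule R Q} (hN : N.IsCountablyGenerated)
    (h : ∀ r ∈ N, ∃ θ : Q →ₗ[R] N, (θ r : Q) = r) : Module.Projective R N := by
  obtain ⟨r, hr, hspan⟩ := hN.exists_seq
  obtain ⟨p, hp⟩ := hN.exists_surjective
  have hstep : ∀ (E : Q →ₗ[R] N) (j : ℕ), ∃ θ : Q →ₗ[R] (ℕ →₀ R),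
      (p (θ (r j - E (r j))) : Q) = r j - E (r j) := fun E j => by
    obtain ⟨θ, hθ⟩ := h (r j - E (r j)) (sub_mem (hr j) (E (r j)).2)
    obtain ⟨θ', hθ'⟩ := Module.projective_lifting_property p θ hp
    exact ⟨θ', (congrArg Subtype.val (LinearMap.congr_fun hθ' _)).trans hθ⟩
  choose θ hθ using hstep
  let L : (Q →ₗ[R] N) → ℕ → (Q →ₗ[R] (ℕ →₀ R)) := fun E j =>
    θ E j ∘ₗ (LinearMap.id - N.subtype ∘ₗ E)
  let E : ℕ → (Q →ₗ[R] N) := fun j => Nat.rec 0 (fun j E => E + p ∘ₗ L E j) j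
  have hE : ∀ j, E (j + 1) = E j + p ∘ₗ L (E j) j := fun j => rfl
  have hLfix : ∀ j x, (E j x : Q) = x → L (E j) j x = 0 := fun j x hx => by simp [L, hx]
  have hEfix : ∀ j x, (E j x : Q) = x → (E (j + 1) x : Q) = x := fun j x hx => by
    simp [hE, hLfix j x hx, hx]
  have hEfix' : ∀ i j x, i ≤ j → (E i x : Q) = x → (E j x : Q) = x := fun i j x hij hx => by
    induction j, hij using Nat.le_induction with
    | base => exact hx
    | succ j _ ih => exact hEfix j x ih
  have hEr : ∀ j, (E (j + 1) (r j) : Q) = r j := fun j => by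
    change (E j (r j) : Q) + (p (θ (E j) j (r j - E j (r j))) : Q) = _
    rw [hθ, add_sub_cancel]
  have hev : ∀ x ∈ N, ∃ J, (E J x : Q) = x := fun x hx => by
    rw [← hspan] at hx
    induction hx using Submodule.span_induction with
    | mem x hx =>
      obtain ⟨j, rfl⟩ := hx
      exact ⟨j + 1, hEr j⟩
    | zero => exact ⟨0, by simp⟩
    | add x y _ _ hx hy =>
      obtain ⟨i, hi⟩ := hx
      obtain ⟨j, hj⟩ := hy
      refine ⟨max i j, ?_⟩
      simp [hEfix' _ _ _ (le_max_left i j) hi, hEfix' _ _ _ (le_max_right i j) hj]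
    | smul a x _ hx =>
      obtain ⟨i, hi⟩ := hx
      exact ⟨i, by simp [hi]⟩
  have hfin : ∀ (x : N) (J : ℕ), (E J x : Q) = x →
      (Function.support fun j => L (E j) j x) ⊆ (Finset.range J : Set ℕ) := fun x J hJ j hj => by
    by_contra hjJ
    exact hj (hLfix _ _ (hEfix' J j x (by simpa using hjJ) hJ))
  let s : N →ₗ[R] (ℕ →₀ R) :=
    { toFun := fun x => ∑ᶠ j, L (E j) j x
      map_add' := fun x y => by
        obtain ⟨i, hi⟩ := hev x x.2
        obtain ⟨j, hj⟩ := hev y y.2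
        rw [← finsum_add_distrib ((Finset.finite_toSet _).subset (hfin x i hi))
          ((Finset.finite_toSet _).subset (hfin y j hj))]
        simp
      map_smul' := fun a x => by
        obtain ⟨i, hi⟩ := hev x x.2
        simp only [Submodule.coe_smul, map_smul, RingHom.id_apply]
        rw [finsum_eq_sum_of_support_subset _ (hfin x i hi), finsum_eq_sum_of_support_subset
          (fun j => a • L (E j) j (x : Q)) ((Function.support_const_smul_subset a
          fun j => L (E j) j (x : Q)).trans (hfin x i hi)), Finset.smul_sum] }
  refine Module.Projective.of_split s p (LinearMap.ext fun x => ?_)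
  obtain ⟨J, hJ⟩ := hev x x.2
  have hsum : ∀ J, ∑ j ∈ Finset.range J, p (L (E j) j x) = E J x := fun J => by
    induction J with
    | zero => rfl
    | succ J ih => rw [Finset.sum_range_succ, ih, hE]; rfl
  change p (∑ᶠ j, L (E j) j x) = x
  rw [finsum_eq_sum_of_support_subset _ (hfin x J hJ), map_sum, hsum]
  exact Subtype.ext hJ

end LocalSplitting

section CountableSyzygies

variable {R : Type u} [Ring R]

theorem ExtVanish.map_of_ker_inf {K Q Y X : Type u} [AddCommGroup K] [Module R K]
    [AddCommGroup Q] [Module R Q] [AddCommGroup Y] [Module R Y] [AddCommGroup X] [Module R X]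
    (f : Q →ₗ[R] Y) (Q' : Submodule R Q) [Module.Projective R Q'] {ι : K →ₗ[R] Q}
    (hι : Function.Injective ι) (hker : LinearMap.range ι = LinearMap.ker f ⊓ Q') {m : ℕ}
    (h : ExtVanish R K X m) : ExtVanish R (Q'.map f) X (m + 1) := by
  have hmem : ∀ x, ι x ∈ LinearMap.ker f ⊓ Q' := fun x => hker ▸ LinearMap.mem_range_self ι x
  refine ExtVanish.right (A := K) (B := Q') (C := Q'.map f) (i := ι.codRestrict Q' fun x => (hmem x).2)
    (f := f.submoduleMap Q') ?_ (f.submoduleMap_surjective Q') ?_ h (extVanish_of_projective m)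
  · intro x y hxy
    exact hι (congrArg Subtype.val hxy)
  · rintro ⟨q, hq⟩
    constructor
    · intro h0
      have : q ∈ LinearMap.range ι := hker ▸ ⟨congrArg Subtype.val h0, hq⟩
      obtain ⟨x, rfl⟩ := this
      exact ⟨x, rfl⟩
    · rintro ⟨x, hx⟩
      rw [← hx]
      exact Subtype.ext (hmem x).1

theorem IsLeftAleph0Noetherian.exists_countable_support (hR : IsLeftAleph0Noetherian R)
    {X Y : Type u} [AddCommGroup Y] [Module R Y] (f : (X →₀ R) →ₗ[R] Y)
    (h : ∀ r, f r = 0 → ∃ θ : (X →₀ R) →ₗ[R] (X →₀ R), (∀ q, f (θ q) = 0) ∧ θ r = r)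
    (T : Finset X) :
    ∃ S : Set X, S.Countable ∧ ∀ r, f r = 0 → r ∈ Finsupp.supported R R (T : Set X) →
      ∃ θ : (X →₀ R) →ₗ[R] (X →₀ R),
        (∀ q, f (θ q) = 0 ∧ θ q ∈ Finsupp.supported R R S) ∧ θ r = r := by
  classical
  obtain ⟨r, hr, hspan⟩ := (hR.isCountablyGenerated_of_le_supported_finset T
    (N := LinearMap.ker f ⊓ Finsupp.supported R R (T : Set X)) inf_le_right).exists_seq
  have h' : ∀ r ∈ LinearMap.ker f, ∃ θ : (X →₀ R) →ₗ[R] LinearMap.ker f, (θ r : X →₀ R) = r :=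
    fun r hr => by
      obtain ⟨θ, h1, h2⟩ := h r hr
      exact ⟨θ.codRestrict _ h1, h2⟩
  choose θ hθ using Submodule.exists_linearMap_fix_finite h' r fun i => (hr i).1
  refine ⟨⋃ j, ⋃ x ∈ T, ((θ j (Finsupp.single x 1) : X →₀ R).support : Set X),
    Set.countable_iUnion fun j => T.countable_toSet.biUnion fun x _ =>
      Finset.countable_toSet _, fun q hq hqT => ?_⟩
  have hfix : ∃ J, ∀ j, J ≤ j → (θ j q : X →₀ R) = q := by
    have hq' : q ∈ Submodule.span R (Set.range r) := hspan ▸ ⟨hq, hqT⟩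
    clear hq hqT
    induction hq' using Submodule.span_induction with
    | mem x hx =>
      obtain ⟨j, rfl⟩ := hx
      exact ⟨j + 1, fun i hi => hθ i j hi⟩
    | zero => exact ⟨0, by simp⟩
    | add x y _ _ hx hy =>
      obtain ⟨i, hi⟩ := hx
      obtain ⟨j, hj⟩ := hy
      exact ⟨max i j, fun k hk => by
        simp [hi k (le_trans (le_max_left i j) hk), hj k (le_trans (le_max_right i j) hk)]⟩
    | smul a x _ hx =>
      obtain ⟨i, hi⟩ := hx
      exact ⟨i, fun k hk => by simp [hi k hk]⟩
  obtain ⟨J, hJ⟩ := hfix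
  let η : (X →₀ R) →ₗ[R] LinearMap.ker f := Finsupp.linearCombination R fun x =>
    if x ∈ T then θ J (Finsupp.single x 1) else 0
  refine ⟨(LinearMap.ker f).subtype ∘ₗ η, fun q => ⟨(η q).2, ?_⟩, ?_⟩
  · induction q using Finsupp.induction_linear with
    | zero => simp
    | add f g hf hg => rw [map_add]; exact add_mem hf hg
    | single x c =>
      by_cases hx : x ∈ T
      · have : ((LinearMap.ker f).subtype ∘ₗ η) (Finsupp.single x c) =
          c • (θ J (Finsupp.single x 1) : X →₀ R) := by simp [η, hx]
        rw [this]
        refine Submodule.smul_mem _ _ ((Finsupp.mem_supported _ _).2 fun y hy => ?_)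
        exact Set.mem_iUnion.2 ⟨J, Set.mem_biUnion hx hy⟩
      · simp [η, hx]
  · have hagree : ∀ p ∈ Finsupp.supported R R (T : Set X), η p = θ J p := fun p hp => by
      rw [Finsupp.supported_eq_span_single] at hp
      induction hp using Submodule.span_induction with
      | mem x hx =>
        obtain ⟨y, hy, rfl⟩ := hx
        have hy' : y ∈ T := hy
        simp [η, hy']
      | zero => simp
      | add x y _ _ hx hy => simp [hx, hy]
      | smul a x _ hx => simp [hx]
    change (η q : X →₀ R) = q
    rw [hagree q hqT, hJ J le_rfl]

theorem IsLeftAleph0Noetherian.exists_submodule_extVanish (hR : IsLeftAleph0Noetherian R)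
    (Y : ModuleCat.{u} R) (n : ℕ)
    (h : ∀ r, freeCover R (iteratedSyzygy Y n) r = 0 →
      ∃ θ : (iteratedSyzygy Y n →₀ R) →ₗ[R] (iteratedSyzygy Y n →₀ R),
        (∀ q, freeCover R (iteratedSyzygy Y n) (θ q) = 0) ∧ θ r = r) (a : Y) :
    ∃ A : Submodule R Y, a ∈ A ∧
      ∀ (X : Type u) [AddCommGroup X] [Module R X], ExtVanish R A X (n + 2) := by
  classical
  let Z : ℕ → ModuleCat.{u} R := iteratedSyzygy Y
  let f : ∀ i, (Z i →₀ R) →ₗ[R] Z i := fun i => freeCover R (Z i)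
  let ι : ∀ i, Z (i + 1) →ₗ[R] (Z i →₀ R) := fun i => (LinearMap.ker (f i)).subtype
  have hι : ∀ i, Function.Injective (ι i) := fun i => Submodule.injective_subtype _
  have hιf : ∀ i, LinearMap.range (ι i) = LinearMap.ker (f i) := fun i => Submodule.range_subtype _
  have hup : ∀ i (T : Finset (Z i)), ∃ s : Set (Z (i + 1)), s.Countable ∧
      (Submodule.span R s).map (ι i) = LinearMap.ker (f i) ⊓ Finsupp.supported R R (T : Set (Z i)) := by
    intro i T
    obtain ⟨s, hs, hspan⟩ := hR.isCountablyGenerated_of_le_supported_finset T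
      (N := LinearMap.ker (f i) ⊓ Finsupp.supported R R (T : Set (Z i))) inf_le_right
    refine ⟨ι i ⁻¹' s, hs.preimage (hι i), ?_⟩
    rw [Submodule.map_span, Set.image_preimage_eq_of_subset, hspan]
    intro x hx
    have : x ∈ LinearMap.ker (f i) := (hspan ▸ Submodule.subset_span hx :
      x ∈ LinearMap.ker (f i) ⊓ Finsupp.supported R R (T : Set (Z i))).1
    rw [← hιf] at this
    exact this
  have hsame : ∀ i (T : Finset (Z i)), ∃ S : Set (Z i), S.Countable ∧ (i = n → ∀ r, f i r = 0 →
      r ∈ Finsupp.supported R R (T : Set (Z i)) →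
      ∃ θ : (Z i →₀ R) →ₗ[R] (Z i →₀ R),
        (∀ q, f i (θ q) = 0 ∧ θ q ∈ Finsupp.supported R R S) ∧ θ r = r) := by
    intro i T
    by_cases hi : i = n
    · subst hi
      obtain ⟨S, h1, h2⟩ := hR.exists_countable_support (f i) h T
      exact ⟨S, h1, fun _ => h2⟩
    · exact ⟨∅, Set.countable_empty, fun hi' => absurd hi' hi⟩
  choose up hup_c hup using hup
  choose same hsame_c hsame using hsame
  let mk : ∀ i, Z i → Σ i, Z i := fun i x => ⟨i, x⟩
  have hmk : ∀ i, Function.Injective (mk i) := fun i x y h => by simpa [mk] using h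
  let proj : ∀ i, Finset (Σ i, Z i) → Finset (Z i) := fun i T =>
    T.preimage (mk i) (hmk i).injOn
  obtain ⟨W, hW₀, hWc, hW⟩ := exists_countable_closure
    (fun T : Finset (Σ i, Z i) => ⋃ i, (mk (i + 1) '' up i (proj i T) ∪
      mk i '' same i (proj i T)) ∪
      ⋃ y ∈ proj (i + 1) T, mk i '' ((ι i y).support : Set (Z i)))
    (fun T => Set.countable_iUnion fun i => (((hup_c _ _).image _).union
      ((hsame_c _ _).image _)).union ((Finset.countable_toSet _).biUnion fun y _ =>
        (Finset.countable_toSet _).image _)) (Set.countable_singleton (⟨0, a⟩ : Σ i, Z i))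
  let V : ∀ i, Set (Z i) := fun i => mk i ⁻¹' W
  have hVc : ∀ i, (V i).Countable := fun i => hWc.preimage (hmk i)
  have hlift : ∀ i (T : Finset (Z i)), (T : Set (Z i)) ⊆ V i → ∃ T' : Finset (Σ i, Z i),
      (T' : Set (Σ i, Z i)) ⊆ W ∧ proj i T' = T := fun i T hT => by
    refine ⟨T.image (mk i), by simpa [Set.subset_def, V] using hT, ?_⟩
    ext x
    simp [proj, (hmk i).eq_iff]
  have hVup : ∀ i (T : Finset (Z i)), (T : Set (Z i)) ⊆ V i → up i T ⊆ V (i + 1) :=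
    fun i T hT x hx => by
      obtain ⟨T', hT', rfl⟩ := hlift i T hT
      exact hW T' hT' (Set.mem_iUnion.2 ⟨i, Or.inl (Or.inl ⟨x, hx, rfl⟩)⟩)
  have hVsame : ∀ i (T : Finset (Z i)), (T : Set (Z i)) ⊆ V i → same i T ⊆ V i :=
    fun i T hT x hx => by
      obtain ⟨T', hT', rfl⟩ := hlift i T hT
      exact hW T' hT' (Set.mem_iUnion.2 ⟨i, Or.inl (Or.inr ⟨x, hx, rfl⟩)⟩)
  have hVdown : ∀ i, ∀ y ∈ V (i + 1), ((ι i y).support : Set (Z i)) ⊆ V i := fun i y hy x hx => by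
    obtain ⟨T', hT', hT⟩ := hlift (i + 1) {y} (by simpa using hy)
    refine hW T' hT' (Set.mem_iUnion.2 ⟨i, Or.inr (Set.mem_biUnion (x := y) ?_ ⟨x, hx, rfl⟩)⟩)
    simp [hT]
  have hproj : ∀ i, Module.Projective R (Finsupp.supported R R (V i)) := fun i =>
    .of_equiv (Finsupp.supportedEquivFinsupp (V i)).symm
  have hmap : ∀ i, (Finsupp.supported R R (V i)).map (f i) = Submodule.span R (V i) := fun i => by
    rw [← Set.image_id (V i), Finsupp.span_image_eq_map_linearCombination, Set.image_id]
    rfl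
  have hfix : ∀ r ∈ LinearMap.ker (f n) ⊓ Finsupp.supported R R (V n),
      ∃ θ : (Z n →₀ R) →ₗ[R] ↥(LinearMap.ker (f n) ⊓ Finsupp.supported R R (V n)),
        (θ r : Z n →₀ R) = r := fun r hr => by
    have hrV := (Finsupp.mem_supported _ _).1 hr.2
    obtain ⟨θ, h1, h2⟩ := hsame n r.support rfl r hr.1 ((Finsupp.mem_supported _ _).2 subset_rfl)
    exact ⟨θ.codRestrict _ fun q => ⟨(h1 q).1,
      Finsupp.supported_mono (hVsame n _ hrV) (h1 q).2⟩, h2⟩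
  have hstep : ∀ i, (Submodule.span R (V (i + 1))).map (ι i) =
      LinearMap.ker (f i) ⊓ Finsupp.supported R R (V i) := fun i => by
    apply le_antisymm
    · rw [Submodule.map_span, Submodule.span_le]
      rintro _ ⟨y, hy, rfl⟩
      exact ⟨hιf i ▸ LinearMap.mem_range_self _ y, (Finsupp.mem_supported _ _).2 (hVdown i y hy)⟩
    · intro x hx
      have hxV := (Finsupp.mem_supported _ _).1 hx.2
      have : x ∈ (Submodule.span R (up i x.support)).map (ι i) := by
        rw [hup]
        exact ⟨hx.1, (Finsupp.mem_supported _ _).2 subset_rfl⟩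
      exact Submodule.map_mono (Submodule.span_mono (hVup i _ hxV)) this
  have key : ∀ d i, i + d = n → ∀ (X : Type u) [AddCommGroup X] [Module R X],
      ExtVanish R (Submodule.span R (V i)) X (d + 2) := by
    intro d
    induction d with
    | zero =>
      rintro i rfl X _ _
      have := (hR.isCountablyGenerated_of_le_supported (hVc i) (N := LinearMap.ker (f i) ⊓
        Finsupp.supported R R (V i)) inf_le_right).projective_of_local_splitting hfix
      rw [← hmap]
      exact ExtVanish.map_of_ker_inf (f i) _ (Submodule.injective_subtype
        (LinearMap.ker (f i) ⊓ Finsupp.supported R R (V i)))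
        (Submodule.range_subtype _) (extVanish_of_projective 0)
    | succ d ih =>
      intro i hi X _ _
      rw [← hmap]
      refine ExtVanish.map_of_ker_inf (f i) _ (ι := ι i ∘ₗ (Submodule.span R (V (i + 1))).subtype)
        ((hι i).comp (Submodule.injective_subtype _)) ?_ (ih (i + 1) (by omega) X)
      rw [LinearMap.range_comp, Submodule.range_subtype, hstep]
  exact ⟨Submodule.span R (V 0), Submodule.subset_span (hW₀ rfl), fun X _ _ => key n 0 n.zero_add X⟩

/-- Over a left `ℵ₀`-noetherian ring of finite `silp`, every element of a twisted dual of the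
regular module lies in a submodule of finite projective dimension. -/
theorem exists_submodule_extVanish_of_silp_le (hR : IsLeftAleph0Noetherian R)
    {t t' : R →+* Rᵐᵒᵖ} (ht : ∀ c, (t (t' c).unop).unop = c)
    (ht' : ∀ c, (t' (t c).unop).unop = c) {n : ℕ} (hn : silp R ≤ n) (a : TwistedDual t R) :
    ∃ A : Submodule R (TwistedDual t R), a ∈ A ∧
      ∀ (X : Type u) [AddCommGroup X] [Module R X], ExtVanish R A X (n + 2) := by
  rw [silp_le_iff] at hn
  refine hR.exists_submodule_extVanish (ModuleCat.of R (TwistedDual t R)) n (fun r hr => ?_) a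
  refine exists_local_splitting ht' _ (freeCover_surjective _) (fun I => ?_) r hr
  refine extVanish_dual_iteratedSyzygy ht ht' _ n 0 ?_
  have hsurj : Function.Surjective
      (Finsupp.linearCombination R fun _ : ℕ => (I.mkQ 1 : R ⧸ I)) := fun x => by
    obtain ⟨x, rfl⟩ := I.mkQ_surjective x
    refine ⟨Finsupp.single 0 x, ?_⟩
    rw [Finsupp.linearCombination_single, ← map_smul, smul_eq_mul, mul_one]
  refine extVanish_doubleDual hR ht n hsurj fun j => ⟨?_, ?_⟩
  · exact extVanish_of_le_of_forall_fst R (Nat.le_add_right n j)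
      (fun X _ _ => hn R inferInstance X) _
  · exact extVanish_of_le_of_forall_fst (ℕ →₀ R) (Nat.le_add_right n j)
      (fun X _ _ => hn (ℕ →₀ R) inferInstance X) _

end CountableSyzygies

section DiagonalTensor

/-- The tensor product over `k` of two `H`-modules, carrying the diagonal action of `H`. -/
def DTensor (k : Type u) [CommRing k] (_H M N : Type u) [AddCommGroup M] [Module k M]
    [AddCommGroup N] [Module k N] : Type u :=
  M ⊗[k] N

namespace DTensor

section Basic

variable (k : Type u) [CommRing k] (H M N : Type u) [AddCommGroup M] [Module k M]
  [AddCommGroup N] [Module k N]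

noncomputable instance : AddCommGroup (DTensor k H M N) :=
  inferInstanceAs (AddCommGroup (M ⊗[k] N))

noncomputable instance : Module k (DTensor k H M N) := inferInstanceAs (Module k (M ⊗[k] N))

/-- The identity map from the tensor product to the diagonal tensor product. -/
noncomputable def of : M ⊗[k] N ≃ₗ[k] DTensor k H M N := LinearEquiv.refl k _

variable {k H M N}

/-- A pure tensor, as an element of the diagonal tensor product. -/
noncomputable def tmul (m : M) (n : N) : DTensor k H M N := of k H M N (m ⊗ₜ n)

theorem of_tmul (m : M) (n : N) : of k H M N (m ⊗ₜ n) = tmul m n := rfl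

@[elab_as_elim]
theorem induction_on {p : DTensor k H M N → Prop} (x : DTensor k H M N) (zero : p 0)
    (tmul : ∀ m n, p (tmul m n)) (add : ∀ x y, p x → p y → p (x + y)) : p x :=
  TensorProduct.induction_on (motive := p) x zero tmul add

theorem tmul_add (m : M) (n n' : N) :
    (tmul m (n + n') : DTensor k H M N) = tmul m n + tmul m n' := TensorProduct.tmul_add _ _ _

theorem tmul_smul (c : k) (m : M) (n : N) :
    (tmul m (c • n) : DTensor k H M N) = c • tmul m n := TensorProduct.tmul_smul _ _ _

theorem smul_tmul_left (c : k) (m : M) (n : N) :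
    (tmul (c • m) n : DTensor k H M N) = c • tmul m n := TensorProduct.smul_tmul' _ _ _ |>.symm

theorem tmul_sum {ι : Type*} (s : Finset ι) (m : M) (n : ι → N) :
    (tmul m (∑ i ∈ s, n i) : DTensor k H M N) = ∑ i ∈ s, tmul m (n i) := by
  simp only [tmul, TensorProduct.tmul_sum, map_sum]

end Basic

variable {k : Type u} [CommRing k] {H : Type u} [Ring H] [HopfAlgebra k H]
  {M N : Type u} [AddCommGroup M] [Module k M] [Module H M] [IsScalarTower k H M]
  [AddCommGroup N] [Module k N] [Module H N] [IsScalarTower k H N]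

noncomputable instance : Module H (DTensor k H M N) := tensorModule k H M N

theorem smul_of (h : H) (x : M ⊗[k] N) : h • of k H M N x = of k H M N (tensorRep k H M N h x) :=
  rfl

instance : IsScalarTower k H (DTensor k H M N) where
  smul_assoc c h x := by
    obtain ⟨x, rfl⟩ := (of k H M N).surjective x
    rw [smul_of, smul_of, map_smul, LinearMap.smul_apply, map_smul]

theorem smul_tmul {h : H} {ι : Type*} (r : Coalgebra.Repr k h ι) (m : M) (n : N) :
    h • (tmul m n : DTensor k H M N) =
      ∑ i ∈ r.index, tmul (r.left i • m) (r.right i • n) := by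
  rw [tmul, smul_of]
  simp only [tensorRep, AlgHom.comp_apply, Bialgebra.comulAlgHom_apply, ← r.eq, map_sum,
    LinearMap.sum_apply, Algebra.TensorProduct.map_tmul]
  rfl

section Map

variable {P Q : Type u} [AddCommGroup P] [Module k P] [Module H P] [IsScalarTower k H P]
  [AddCommGroup Q] [Module k Q] [Module H Q] [IsScalarTower k H Q]

/-- The map of diagonal tensor products induced by two linear maps. -/
noncomputable def map (f : M →ₗ[H] P) (g : N →ₗ[H] Q) :
    DTensor k H M N →ₗ[H] DTensor k H P Q where
  toFun x := of k H P Q (TensorProduct.map (f.restrictScalars k) (g.restrictScalars k)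
    ((of k H M N).symm x))
  map_add' x y := by simp
  map_smul' h x := by
    induction x using DTensor.induction_on with
    | zero => simp
    | add x y hx hy => simp only [smul_add, map_add, hx, hy]
    | tmul m n =>
      rw [smul_tmul (Coalgebra.Repr.arbitrary k h)]
      simp only [tmul, map_sum, LinearEquiv.symm_apply_apply, TensorProduct.map_tmul,
        LinearMap.restrictScalars_apply, map_smul, RingHom.id_apply]
      exact (smul_tmul (Coalgebra.Repr.arbitrary k h) (f m) (g n)).symm

@[simp] theorem map_tmul (f : M →ₗ[H] P) (g : N →ₗ[H] Q) (m : M) (n : N) :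
    map f g (tmul m n : DTensor k H M N) = (tmul (f m) (g n) : DTensor k H P Q) := rfl

theorem map_surjective {f : M →ₗ[H] P} {g : N →ₗ[H] Q} (hf : Function.Surjective f)
    (hg : Function.Surjective g) :
    Function.Surjective (map f g : DTensor k H M N →ₗ[H] DTensor k H P Q) :=
  TensorProduct.map_surjective (R := k) (g := f.restrictScalars k) (g' := g.restrictScalars k) hf hg

end Map

/-- Tensoring on the left with an element on which `H` acts through the counit. -/
noncomputable def insertLeft {a : M} (ha : ∀ h : H, h • a = Coalgebra.counit (R := k) h • a) :
    N →ₗ[H] DTensor k H M N where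
  toFun n := tmul a n
  map_add' n n' := tmul_add a n n'
  map_smul' h n := by
    rw [RingHom.id_apply, smul_tmul (Coalgebra.Repr.arbitrary k h)]
    simp only [ha, smul_tmul_left, ← tmul_smul, ← tmul_sum]
    congr 1
    simp only [← smul_assoc, ← Finset.sum_smul, Coalgebra.sum_counit_smul]

@[simp] theorem insertLeft_apply {a : M}
    (ha : ∀ h : H, h • a = Coalgebra.counit (R := k) h • a) (n : N) :
    (insertLeft ha n : DTensor k H M N) = tmul a n := rfl

end DTensor

end DiagonalTensor

section DiagonalTensorField

variable {k : Type u} [Field k] {H : Type u} [Ring H] [HopfAlgebra k H]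
  {M N : Type u} [AddCommGroup M] [Module k M] [Module H M] [IsScalarTower k H M]
  [AddCommGroup N] [Module k N] [Module H N] [IsScalarTower k H N]
  {A B C : Type u} [AddCommGroup A] [Module k A] [Module H A] [IsScalarTower k H A]
  [AddCommGroup B] [Module k B] [Module H B] [IsScalarTower k H B]
  [AddCommGroup C] [Module k C] [Module H C] [IsScalarTower k H C]

namespace DTensor

theorem map_id_left_injective {f : A →ₗ[H] B} (hf : Function.Injective f) :
    Function.Injective (map (LinearMap.id : M →ₗ[H] M) f : DTensor k H M A →ₗ[H] DTensor k H M B) :=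
  Module.Flat.lTensor_preserves_injective_linearMap (M := M) (f.restrictScalars k) hf

theorem map_id_right_injective {f : A →ₗ[H] B} (hf : Function.Injective f) :
    Function.Injective (map f (LinearMap.id : M →ₗ[H] M) : DTensor k H A M →ₗ[H] DTensor k H B M) :=
  Module.Flat.rTensor_preserves_injective_linearMap (M := M) (f.restrictScalars k) hf

theorem map_id_left_exact {i : A →ₗ[H] B} {f : B →ₗ[H] C} (hex : Function.Exact i f)
    (hf : Function.Surjective f) :
    Function.Exact (map (LinearMap.id : M →ₗ[H] M) i : DTensor k H M A →ₗ[H] DTensor k H M B)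
      (map (LinearMap.id : M →ₗ[H] M) f : DTensor k H M B →ₗ[H] DTensor k H M C) :=
  lTensor_exact (f := i.restrictScalars k) (g := f.restrictScalars k) M hex hf

theorem map_id_right_exact {i : A →ₗ[H] B} {f : B →ₗ[H] C} (hex : Function.Exact i f)
    (hf : Function.Surjective f) :
    Function.Exact (map i (LinearMap.id : M →ₗ[H] M) : DTensor k H A M →ₗ[H] DTensor k H B M)
      (map f (LinearMap.id : M →ₗ[H] M) : DTensor k H B M →ₗ[H] DTensor k H C M) :=
  rTensor_exact (f := i.restrictScalars k) (g := f.restrictScalars k) M hex hf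

theorem insertLeft_injective {a : M} (ha : ∀ h : H, h • a = Coalgebra.counit (R := k) h • a)
    (ha0 : a ≠ 0) : Function.Injective (insertLeft ha : N →ₗ[H] DTensor k H M N) := by
  have h1 : Function.Injective (LinearMap.toSpanSingleton k M a) :=
    LinearMap.ker_eq_bot.1 (LinearMap.ker_toSpanSingleton k ha0)
  have h2 := Module.Flat.rTensor_preserves_injective_linearMap (M := N) _ h1
  have h3 : ∀ n : N, (LinearMap.toSpanSingleton k M a).rTensor N ((TensorProduct.lid k N).symm n) =
      (insertLeft ha n : DTensor k H M N) := fun n => by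
    simp only [TensorProduct.lid_symm_apply, LinearMap.rTensor_tmul,
      LinearMap.toSpanSingleton_apply, one_smul]
    rfl
  intro x y hxy
  refine (TensorProduct.lid k N).symm.injective (h2 ?_)
  rw [h3, h3, hxy]

end DTensor

end DiagonalTensorField

section DiagonalTensorProjective

variable {k : Type u} [Field k] {H : Type u} [Ring H] [HopfAlgebra k H]
  {M N F : Type u} [AddCommGroup M] [Module k M] [Module H M] [IsScalarTower k H M]
  [AddCommGroup N] [Module k N] [Module H N] [IsScalarTower k H N]
  [AddCommGroup F] [Module k F] [Module H F] [IsScalarTower k H F]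

open Coalgebra HopfAlgebra

theorem Coalgebra.Repr.sum_map_coassoc {X : Type u} [AddCommGroup X] [Module k X]
    (Λ : H ⊗[k] (H ⊗[k] H) →ₗ[k] X) {c : H} (r : Coalgebra.Repr k c (H × H)) :
    ∑ i ∈ r.index, ∑ j ∈ (Repr.arbitrary k (r.left i)).index,
      Λ ((Repr.arbitrary k (r.left i)).left j ⊗ₜ
        ((Repr.arbitrary k (r.left i)).right j ⊗ₜ r.right i)) =
    ∑ i ∈ r.index, ∑ j ∈ (Repr.arbitrary k (r.right i)).index,
      Λ (r.left i ⊗ₜ ((Repr.arbitrary k (r.right i)).left j ⊗ₜ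
        (Repr.arbitrary k (r.right i)).right j)) := by
  simpa only [map_sum] using congrArg Λ (Coalgebra.sum_tmul_tmul_eq r
    (fun i => Repr.arbitrary k (r.left i)) (fun i => Repr.arbitrary k (r.right i)))

theorem Coalgebra.Repr.sum_smul_counit {c : H} (r : Coalgebra.Repr k c (H × H)) :
    ∑ i ∈ r.index, counit (R := k) (r.right i) • r.left i = c := by
  simpa only [map_sum, TensorProduct.AlgebraTensorModule.rid_tmul, one_smul] using
    congrArg (TensorProduct.AlgebraTensorModule.rid k k H) (sum_tmul_counit_eq (R := k) r)

variable (k M) in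
/-- The bilinear map `(h, m) ↦ T h • m`, as a map out of the tensor product. -/
noncomputable def twistedAction (T : H →ₗ[k] H) : H ⊗[k] M →ₗ[k] M :=
  TensorProduct.lift ((Algebra.lsmul k k M : H →ₐ[k] Module.End k M).toLinearMap ∘ₗ T)

@[simp] theorem twistedAction_tmul (T : H →ₗ[k] H) (h : H) (m : M) :
    twistedAction k M T (h ⊗ₜ m) = T h • m := rfl

theorem sum_antipode_smul_smul {h : H} (r : Coalgebra.Repr k h (H × H)) (m : M) :
    ∑ i ∈ r.index, antipode k (r.left i) • r.right i • m = counit (R := k) h • m := by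
  simp only [← mul_smul, ← Finset.sum_smul, sum_antipode_mul_eq_smul, smul_assoc, one_smul]

theorem sum_smul_antipode_smul {h : H} (r : Coalgebra.Repr k h (H × H)) (m : M) :
    ∑ i ∈ r.index, r.left i • antipode k (r.right i) • m = counit (R := k) h • m := by
  simp only [← mul_smul, ← Finset.sum_smul, sum_mul_antipode_eq_smul, smul_assoc, one_smul]

namespace DTensor

variable (k H M) in
/-- The `H`-linear map `h ⊗ m ↦ h • (1 ⊗ m)`. -/
noncomputable def untwistLeft : H ⊗[k] M →ₗ[H] DTensor k H H M :=
  TensorProduct.AlgebraTensorModule.lift (LinearMap.toSpanSingleton H _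
    ((of k H H M).toLinearMap ∘ₗ TensorProduct.mk k H M 1))

theorem untwistLeft_tmul (h : H) (m : M) :
    untwistLeft k H M (h ⊗ₜ m) = h • (tmul 1 m : DTensor k H H M) := rfl

variable (k H M) in
/-- The inverse of `untwistLeft`, sending `h ⊗ m` to `h₁ ⊗ S(h₂) m`. -/
noncomputable def twistLeft : H ⊗[k] M →ₗ[k] H ⊗[k] M :=
  (twistedAction k M (antipode k)).lTensor H ∘ₗ (TensorProduct.assoc k H H M).toLinearMap ∘ₗ
    (comul (R := k) (A := H)).rTensor M

theorem twistLeft_tmul {h : H} (r : Coalgebra.Repr k h (H × H)) (m : M) :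
    twistLeft k H M (h ⊗ₜ m) = ∑ i ∈ r.index, r.left i ⊗ₜ (antipode k (r.right i) • m) := by
  simp [twistLeft, ← r.eq, TensorProduct.sum_tmul]

theorem untwistLeft_bijective : Function.Bijective (untwistLeft k H M) := by
  refine Function.bijective_iff_has_inverse.2
    ⟨fun x => twistLeft k H M ((of k H H M).symm x), fun x => ?_, fun x => ?_⟩
  · induction x using TensorProduct.induction_on with
    | zero => simp
    | add x y hx hy => simp only [map_add, hx, hy]
    | tmul h m =>
      have := Coalgebra.Repr.sum_map_coassoc (((twistedAction k M (antipode k)) ∘ₗ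
        ((LinearMap.toSpanSingleton H M m).restrictScalars k).lTensor H).lTensor H)
        (Repr.arbitrary k h)
      simp only [LinearMap.lTensor_tmul, LinearMap.comp_apply, twistedAction_tmul,
        LinearMap.restrictScalars_apply, LinearMap.toSpanSingleton_apply,
        ← TensorProduct.tmul_sum, sum_antipode_smul_smul] at this
      rw [untwistLeft_tmul, smul_tmul (Repr.arbitrary k h)]
      simp only [map_sum, tmul, LinearEquiv.symm_apply_apply, smul_eq_mul, mul_one]
      simp only [twistLeft_tmul (Repr.arbitrary k _)]
      rw [this]
      simp only [TensorProduct.tmul_smul, TensorProduct.smul_tmul', ← TensorProduct.sum_tmul]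
      rw [Coalgebra.Repr.sum_smul_counit]
  · induction x using DTensor.induction_on with
    | zero => simp
    | add x y hx hy => simp only [map_add, hx, hy]
    | tmul h m =>
      have := Coalgebra.Repr.sum_map_coassoc ((twistedAction k M LinearMap.id ∘ₗ
        ((LinearMap.toSpanSingleton H M m).restrictScalars k ∘ₗ antipode k).lTensor H).lTensor H)
        (Repr.arbitrary k h)
      simp only [LinearMap.lTensor_tmul, LinearMap.comp_apply, twistedAction_tmul,
        LinearMap.restrictScalars_apply, LinearMap.toSpanSingleton_apply, LinearMap.id_apply,
        ← TensorProduct.tmul_sum, sum_smul_antipode_smul] at this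
      simp only [tmul, LinearEquiv.symm_apply_apply, twistLeft_tmul (Repr.arbitrary k h), map_sum,
        untwistLeft_tmul]
      simp only [of_tmul, smul_tmul (Repr.arbitrary k _)]
      simp only [tmul, smul_eq_mul, mul_one, ← map_sum]
      rw [this]
      simp only [TensorProduct.tmul_smul, TensorProduct.smul_tmul', ← TensorProduct.sum_tmul]
      rw [Coalgebra.Repr.sum_smul_counit]

instance : Module.Projective H (DTensor k H H M) :=
  Module.Projective.of_equiv (LinearEquiv.ofBijective _ (untwistLeft_bijective (k := k)))

variable (k H M) in
/-- The `H`-linear map `h ⊗ m ↦ h • (m ⊗ 1)`. -/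
noncomputable def untwistRight : H ⊗[k] M →ₗ[H] DTensor k H M H :=
  TensorProduct.AlgebraTensorModule.lift (LinearMap.toSpanSingleton H _
    ((of k H M H).toLinearMap ∘ₗ (TensorProduct.mk k M H).flip 1))

theorem untwistRight_tmul (h : H) (m : M) :
    untwistRight k H M (h ⊗ₜ m) = h • (tmul m 1 : DTensor k H M H) := rfl

variable (k M) in
/-- The map sending `h ⊗ m` to `h₂ ⊗ T(h₁) m`. -/
noncomputable def twistRight (T : H →ₗ[k] H) : H ⊗[k] M →ₗ[k] H ⊗[k] M :=
  (twistedAction k M T).lTensor H ∘ₗ (TensorProduct.assoc k H H M).toLinearMap ∘ₗ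
    ((TensorProduct.comm k H H).toLinearMap ∘ₗ comul (R := k) (A := H)).rTensor M

theorem twistRight_tmul (T : H →ₗ[k] H) {h : H} (r : Coalgebra.Repr k h (H × H)) (m : M) :
    twistRight k M T (h ⊗ₜ m) = ∑ i ∈ r.index, r.right i ⊗ₜ (T (r.left i) • m) := by
  simp [twistRight, ← r.eq, TensorProduct.sum_tmul]

theorem untwistRight_bijective (T : H →ₗ[k] H)
    (hT : ∀ h : H, ∑ i ∈ (Repr.arbitrary k h).index,
      T ((Repr.arbitrary k h).right i) * (Repr.arbitrary k h).left i = counit (R := k) h • 1)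
    (hT' : ∀ h : H, ∑ i ∈ (Repr.arbitrary k h).index,
      (Repr.arbitrary k h).right i * T ((Repr.arbitrary k h).left i) = counit (R := k) h • 1) :
    Function.Bijective (untwistRight k H M) := by
  refine Function.bijective_iff_has_inverse.2
    ⟨fun x => twistRight k M T (TensorProduct.comm k M H ((of k H M H).symm x)),
      fun x => ?_, fun x => ?_⟩
  · induction x using TensorProduct.induction_on with
    | zero => simp
    | add x y hx hy => simp only [map_add, hx, hy]
    | tmul h m =>
      have := Coalgebra.Repr.sum_map_coassoc ((twistedAction k M T ∘ₗ
        (TensorProduct.comm k M H).toLinearMap ∘ₗ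
        ((LinearMap.toSpanSingleton H M m).restrictScalars k).rTensor H).lTensor H ∘ₗ
        (TensorProduct.comm k (H ⊗[k] H) H).toLinearMap ∘ₗ
        (TensorProduct.assoc k H H H).symm.toLinearMap) (Repr.arbitrary k h)
      simp only [LinearMap.lTensor_tmul, LinearMap.rTensor_tmul, LinearMap.comp_apply,
        twistedAction_tmul, LinearEquiv.coe_coe, TensorProduct.assoc_symm_tmul,
        TensorProduct.comm_tmul,
        LinearMap.restrictScalars_apply, LinearMap.toSpanSingleton_apply,
        ← TensorProduct.tmul_sum, ← mul_smul, ← Finset.sum_smul, hT] at this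
      rw [untwistRight_tmul, smul_tmul (Repr.arbitrary k h)]
      simp only [map_sum, tmul, LinearEquiv.symm_apply_apply, smul_eq_mul, mul_one,
        TensorProduct.comm_tmul]
      simp only [twistRight_tmul T (Repr.arbitrary k _), ← mul_smul]
      rw [← this]
      simp only [smul_assoc, one_smul, TensorProduct.tmul_smul, TensorProduct.smul_tmul',
        ← TensorProduct.sum_tmul]
      rw [Coalgebra.sum_counit_smul]
  · induction x using DTensor.induction_on with
    | zero => simp
    | add x y hx hy => simp only [map_add, hx, hy]
    | tmul m h =>
      have := Coalgebra.Repr.sum_map_coassoc ((twistedAction k M LinearMap.id ∘ₗ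
        (TensorProduct.comm k M H).toLinearMap ∘ₗ
        ((LinearMap.toSpanSingleton H M m).restrictScalars k ∘ₗ T).rTensor H).rTensor H ∘ₗ
        (TensorProduct.assoc k H H H).symm.toLinearMap) (Repr.arbitrary k h)
      simp only [LinearMap.rTensor_tmul, LinearMap.comp_apply, twistedAction_tmul,
        LinearEquiv.coe_coe, TensorProduct.assoc_symm_tmul, TensorProduct.comm_tmul,
        LinearMap.restrictScalars_apply, LinearMap.toSpanSingleton_apply, LinearMap.id_apply,
        ← TensorProduct.sum_tmul, ← mul_smul, ← Finset.sum_smul, hT'] at this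
      simp only [tmul, LinearEquiv.symm_apply_apply, TensorProduct.comm_tmul,
        twistRight_tmul T (Repr.arbitrary k h), map_sum, untwistRight_tmul]
      simp only [of_tmul, smul_tmul (Repr.arbitrary k _)]
      simp only [tmul, smul_eq_mul, mul_one, ← map_sum, ← mul_smul]
      rw [← this]
      simp only [smul_assoc, one_smul, ← TensorProduct.smul_tmul', ← TensorProduct.tmul_smul,
        ← TensorProduct.tmul_sum]
      rw [Coalgebra.sum_counit_smul]

theorem projective_right_self (hS : Function.Bijective (antipode k (A := H))) :
    Module.Projective H (DTensor k H M H) := by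
  let T : H →ₗ[k] H := (LinearEquiv.ofBijective _ hS).symm.toLinearMap
  have hT : ∀ x, antipode k (T x) = x := (LinearEquiv.ofBijective _ hS).apply_symm_apply
  refine Module.Projective.of_equiv (LinearEquiv.ofBijective _ (untwistRight_bijective
    (k := k) (M := M) T (fun h => hS.1 ?_) (fun h => hS.1 ?_)))
  · simp only [map_sum, antipode_mul_antidistrib, hT, map_smul, antipode_one]
    exact sum_antipode_mul_eq_smul _
  · simp only [map_sum, antipode_mul_antidistrib, hT, map_smul, antipode_one]
    exact sum_mul_antipode_eq_smul _

section Finsupp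

variable {ι : Type u}

open Classical in
variable (k H M N ι) in
/-- The diagonal tensor product commutes with direct sums in the first variable. -/
noncomputable def finsuppLeft : DTensor k H (ι →₀ N) M ≃ₗ[H] (ι →₀ DTensor k H N M) where
  toAddEquiv := ((of k H (ι →₀ N) M).symm ≪≫ₗ TensorProduct.finsuppLeft k k N M ι ≪≫ₗ
    Finsupp.mapRange.linearEquiv (of k H N M)).toAddEquiv
  map_smul' h x := by
    induction x using DTensor.induction_on with
    | zero => simp
    | add x y hx hy => simp only [smul_add, AddHom.toFun_eq_coe, map_add] at hx hy ⊢; rw [hx, hy]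
    | tmul f m =>
      rw [smul_tmul (Repr.arbitrary k h)]
      ext i
      simp [tmul]
      simp only [of_tmul, smul_tmul (Repr.arbitrary k h)]

open Classical in
variable (k H M N ι) in
/-- The diagonal tensor product commutes with direct sums in the second variable. -/
noncomputable def finsuppRight : DTensor k H M (ι →₀ N) ≃ₗ[H] (ι →₀ DTensor k H M N) where
  toAddEquiv := ((of k H M (ι →₀ N)).symm ≪≫ₗ TensorProduct.finsuppRight k k M N ι ≪≫ₗ
    Finsupp.mapRange.linearEquiv (of k H M N)).toAddEquiv
  map_smul' h x := by
    induction x using DTensor.induction_on with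
    | zero => simp
    | add x y hx hy => simp only [smul_add, AddHom.toFun_eq_coe, map_add] at hx hy ⊢; rw [hx, hy]
    | tmul m f =>
      rw [smul_tmul (Repr.arbitrary k h)]
      ext i
      simp [tmul]
      simp only [of_tmul, smul_tmul (Repr.arbitrary k h)]

end Finsupp

theorem _root_.Module.Projective.finsupp {R P : Type u} [Ring R] [AddCommGroup P] [Module R P]
    [Module.Projective R P] (ι : Type u) : Module.Projective R (ι →₀ P) := by
  classical
  exact Module.Projective.of_equiv (finsuppLEquivDirectSum R P ι).symm

theorem projective_left [Module.Projective H F] : Module.Projective H (DTensor k H F M) := by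
  obtain ⟨s, hs⟩ := Module.projective_lifting_property (freeCover H F) LinearMap.id
    (freeCover_surjective F)
  have := Module.Projective.finsupp (R := H) (P := DTensor k H H M) F
  have := Module.Projective.of_equiv (finsuppLeft k H M H F).symm
  refine Module.Projective.of_split (map s LinearMap.id : DTensor k H F M →ₗ[H] _)
    (map (freeCover H F) LinearMap.id) ?_
  ext x
  induction x using DTensor.induction_on with
  | zero => simp
  | add x y hx hy => simp only [map_add, hx, hy]
  | tmul f m => simp [show freeCover H F (s f) = f from LinearMap.congr_fun hs f]

theorem projective_right (hS : Function.Bijective (antipode k (A := H)))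
    [Module.Projective H F] : Module.Projective H (DTensor k H M F) := by
  obtain ⟨s, hs⟩ := Module.projective_lifting_property (freeCover H F) LinearMap.id
    (freeCover_surjective F)
  have := projective_right_self (M := M) hS
  have := Module.Projective.finsupp (R := H) (P := DTensor k H M H) F
  have := Module.Projective.of_equiv (finsuppRight k H M H F).symm
  refine Module.Projective.of_split (map LinearMap.id s : DTensor k H M F →ₗ[H] _)
    (map LinearMap.id (freeCover H F)) ?_
  ext x
  induction x using DTensor.induction_on with
  | zero => simp
  | add x y hx hy => simp only [map_add, hx, hy]
  | tmul m f => simp [show freeCover H F (s f) = f from LinearMap.congr_fun hs f]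

theorem extVanish {A : Type u} [AddCommGroup A] [Module k A] [Module H A] [IsScalarTower k H A]
    {n : ℕ} (hA : ∀ (X : Type u) [AddCommGroup X] [Module H X], ExtVanish H A X (n + 1))
    (X : Type u) [AddCommGroup X] [Module H X] : ExtVanish H (DTensor k H A M) X (n + 1) := by
  induction n generalizing A X with
  | zero =>
    have := projective_of_extVanish hA
    have := projective_left (k := k) (M := M) (F := A) (H := H)
    exact extVanish_of_projective 0
  | succ n ih =>
    have hK := ih (A := LinearMap.ker (freeCover H A)) fun X _ _ =>
      ExtVanish.left_of_middle (Submodule.injective_subtype _) (freeCover_surjective A)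
        (exact_ker_subtype _) (extVanish_of_projective n) (hA X)
    have := projective_left (k := k) (M := M) (F := A →₀ H) (H := H)
    exact ExtVanish.right (map_id_right_injective (Submodule.injective_subtype _))
      (map_surjective (freeCover_surjective A) Function.surjective_id)
      (map_id_right_exact (exact_ker_subtype _) (freeCover_surjective A)) (hK X)
      (extVanish_of_projective _)

end DTensor

section Retract

open CategoryTheory Abelian

theorem ExtVanish.of_retract {R : Type u} [Ring R] {A B X : Type u} [AddCommGroup A] [Module R A]
    [AddCommGroup B] [Module R B] [AddCommGroup X] [Module R X] {n : ℕ} (i : A →ₗ[R] B)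
    (r : B →ₗ[R] A) (h : r ∘ₗ i = LinearMap.id) (hB : ExtVanish R B X n) : ExtVanish R A X n := by
  refine subsingleton_of_forall_eq 0 fun x => ?_
  have h1 : ModuleCat.ofHom i ≫ ModuleCat.ofHom r = 𝟙 (ModuleCat.of R A) := by
    rw [← ModuleCat.ofHom_comp, h]; rfl
  rw [← Ext.mk₀_id_comp x, ← h1, ← Ext.mk₀_comp_mk₀, Ext.comp_assoc_of_second_deg_zero,
    show (Ext.mk₀ (ModuleCat.ofHom r)).comp x (zero_add n) = 0 from hB.elim _ _, Ext.comp_zero]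

end Retract

end DiagonalTensorProjective

section SilpSpli

open HopfAlgebra

variable {k : Type u} [Field k] {H : Type u} [Ring H] [HopfAlgebra k H]

section Invariant

variable {A P : Type u} [AddCommGroup A] [Module k A] [Module H A] [IsScalarTower k H A]
  [AddCommGroup P] [Module k P] [Module H P] [IsScalarTower k H P]
  {a : A} (ha : ∀ h : H, h • a = Coalgebra.counit (R := k) h • a) (ha0 : a ≠ 0)

include ha ha0 in
theorem extVanish_of_injective_of_invariant {n : ℕ}
    (hA : ∀ (X : Type u) [AddCommGroup X] [Module H X], ExtVanish H A X (n + 1))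
    (hP : Module.Injective H P) (X : Type u) [AddCommGroup X] [Module H X] :
    ExtVanish H P X (n + 1) := by
  obtain ⟨r, hr⟩ := hP.out (DTensor.insertLeft (N := P) ha)
    (DTensor.insertLeft_injective ha ha0) LinearMap.id
  exact .of_retract (DTensor.insertLeft ha) r (LinearMap.ext hr) (DTensor.extVanish hA X)

include ha in
theorem DTensor.exact_insertLeft_mkQ :
    Function.Exact (DTensor.insertLeft (N := P) ha)
      (DTensor.map (Submodule.span H {a}).mkQ (LinearMap.id : P →ₗ[H] P) :
        DTensor k H A P →ₗ[H] DTensor k H (A ⧸ Submodule.span H {a}) P) := by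
  have hex : Function.Exact (Submodule.span H {a}).subtype (Submodule.span H {a}).mkQ :=
    fun x => by simp
  intro y
  constructor
  · intro hy
    obtain ⟨x, rfl⟩ := (DTensor.map_id_right_exact (k := k) (M := P) hex
      (Submodule.mkQ_surjective _) y).1 hy
    clear hy
    induction x using DTensor.induction_on with
    | zero => exact ⟨0, by rw [map_zero, map_zero]⟩
    | add x y hx hy =>
      obtain ⟨x', hx⟩ := hx
      obtain ⟨y', hy⟩ := hy
      exact ⟨x' + y', by rw [map_add, map_add, hx, hy]⟩
    | tmul b p =>
      obtain ⟨b, hb⟩ := b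
      obtain ⟨h, rfl⟩ := Submodule.mem_span_singleton.1 hb
      refine ⟨Coalgebra.counit (R := k) h • p, ?_⟩
      simp [ha, DTensor.smul_tmul_left]
  · rintro ⟨p, rfl⟩
    have : (Submodule.span H {a}).mkQ a = 0 := by simp
    rw [DTensor.insertLeft_apply, DTensor.map_tmul, this]
    exact TensorProduct.zero_tmul _ _

include ha ha0 in
theorem DTensor.exists_retraction_insertLeft (hS : Function.Bijective (antipode k (A := H)))
    [Module.Projective H P] :
    ∃ r : DTensor k H A P →ₗ[H] P, r ∘ₗ DTensor.insertLeft ha = LinearMap.id := by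
  have := DTensor.projective_right (M := A ⧸ Submodule.span H {a}) (F := P) hS
  exact (extVanish_of_projective 0).exists_extension (DTensor.insertLeft_injective ha ha0)
    (DTensor.map_surjective (Submodule.mkQ_surjective _) Function.surjective_id)
    (DTensor.exact_insertLeft_mkQ ha) LinearMap.id

include ha ha0 in
theorem extVanish_snd_of_dtensor (hS : Function.Bijective (antipode k (A := H)))
    [Module.Projective H P] {n : ℕ} {M : Type u} [AddCommGroup M] [Module k M] [Module H M]
    [IsScalarTower k H M]
    (hM : ∀ (X : Type u) [AddCommGroup X] [Module H X],
      ExtVanish H (DTensor k H A M) X (n + 1)) : ExtVanish H M P (n + 1) := by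
  induction n generalizing M with
  | zero =>
    obtain ⟨r, hr⟩ := DTensor.exists_retraction_insertLeft (P := P) ha ha0 hS
    refine extVanish_one_of_extension (A := LinearMap.ker (freeCover H M))
      (Submodule.injective_subtype _) (freeCover_surjective M)
      (exact_ker_subtype _) (extVanish_of_projective 0) fun g => ?_
    obtain ⟨G, hG⟩ := (hM (DTensor k H A P)).exists_extension
      (DTensor.map_id_left_injective (A := LinearMap.ker (freeCover H M)) (M := A) (k := k)
        (Submodule.injective_subtype _))
      (DTensor.map_surjective Function.surjective_id (freeCover_surjective M))
      (DTensor.map_id_left_exact (A := LinearMap.ker (freeCover H M))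
        (exact_ker_subtype _) (freeCover_surjective M))
      (DTensor.map LinearMap.id g)
    refine ⟨r ∘ₗ G ∘ₗ DTensor.insertLeft ha, LinearMap.ext fun x => ?_⟩
    have h1 := LinearMap.congr_fun hG (DTensor.tmul a x)
    have h2 := LinearMap.congr_fun hr (g x)
    simp only [LinearMap.comp_apply, DTensor.map_tmul, LinearMap.id_apply,
      DTensor.insertLeft_apply] at h1 h2 ⊢
    rw [h1, h2]
  | succ n ih =>
    have := DTensor.projective_right (M := A) (F := M →₀ H) hS
    refine ExtVanish.right (A := LinearMap.ker (freeCover H M)) (Submodule.injective_subtype _)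
      (freeCover_surjective M) (exact_ker_subtype _) (ih fun X _ _ => ?_)
      (extVanish_of_projective _)
    exact ExtVanish.left_of_middle
      (DTensor.map_id_left_injective (A := LinearMap.ker (freeCover H M)) (M := A) (k := k)
        (Submodule.injective_subtype _))
      (DTensor.map_surjective Function.surjective_id (freeCover_surjective M))
      (DTensor.map_id_left_exact (A := LinearMap.ker (freeCover H M))
        (exact_ker_subtype _) (freeCover_surjective M)) (extVanish_of_projective n) (hM X)

end Invariant

/-- The `k`-module structure on an `H`-module, by restriction of scalars. -/
noncomputable abbrev restrictedModule (k : Type u) [Field k] (H : Type u) [Ring H] [Algebra k H]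
    (M : Type u) [AddCommGroup M] [Module H M] : Module k M :=
  Module.compHom M (algebraMap k H)

theorem restrictedModule_isScalarTower (M : Type u) [AddCommGroup M] [Module H M] :
    letI := restrictedModule k H M
    IsScalarTower k H M :=
  letI := restrictedModule k H M
  .of_algebraMap_smul fun _ _ => rfl

variable (k H) in
theorem silp_le_of_spli_le (hS : Function.Bijective (antipode k (A := H))) {n : ℕ}
    (hn : spli H ≤ n) : silp H ≤ n := by
  rw [spli_le_iff] at hn
  rw [silp_le_iff]
  intro P _ _ hP X _ _
  obtain ⟨A, f, hA, hf⟩ := exists_injective_embedding (R := H) (trivMod k H : ModuleCat.{u} H)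
  let := restrictedModule k H A
  let := restrictedModule k H P
  let := restrictedModule k H X
  have := restrictedModule_isScalarTower (k := k) (H := H) A
  have := restrictedModule_isScalarTower (k := k) (H := H) P
  have := restrictedModule_isScalarTower (k := k) (H := H) X
  let e : trivMod k H := (1 : k)
  have he : e ≠ 0 := one_ne_zero (α := k)
  have hinv (h : H) : h • e = algebraMap k H (Coalgebra.counit (R := k) h) • e := by
    change Coalgebra.counit (R := k) h * (1 : k) =
      Coalgebra.counit (R := k) (algebraMap k H (Coalgebra.counit (R := k) h)) * (1 : k)
    rw [Bialgebra.counit_algebraMap]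
  refine extVanish_snd_of_dtensor (A := A) (a := f e) (k := k) (fun h => ?_)
    (fun h => he (hf (h.trans (map_zero f).symm))) hS
    fun Y _ _ => DTensor.extVanish (fun Y _ _ => hn A hA Y) Y
  rw [← map_smul, hinv, map_smul]
  rfl

variable (k H) in
theorem spli_le_of_silp_le (hS : Function.Bijective (antipode k (A := H)))
    (hH : IsLeftAleph0Noetherian H) {n : ℕ} (hn : silp H ≤ n) : spli H ≤ n := by
  obtain ⟨χ, hχ⟩ := CharacterModule.exists_character_apply_ne_zero_of_ne_zero
    (one_ne_zero (α := k))
  let T := (LinearEquiv.ofBijective _ hS).symm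
  have hT (x : H) : antipode k (T x) = x := (LinearEquiv.ofBijective _ hS).apply_symm_apply x
  have hT' (x : H) : T (antipode k x) = x := (LinearEquiv.ofBijective _ hS).symm_apply_apply x
  let t : H →+* Hᵐᵒᵖ := (antipodeAlgHomOp k H : H →+* Hᵐᵒᵖ)
  let t' : H →+* Hᵐᵒᵖ :=
    { toFun x := .op (T x)
      map_one' := congrArg _ (hS.1 (by rw [hT, antipode_one]))
      map_mul' x y := congrArg MulOpposite.op (a₂ := T y * T x)
        (hS.1 (by rw [antipode_mul_antidistrib, hT, hT, hT]))
      map_zero' := congrArg _ (map_zero T)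
      map_add' x y := congrArg _ (map_add T x y) }
  let a : TwistedDual t H := .mk
    ((χ : k →+ AddCircle (1 : ℚ)).comp (Coalgebra.counit (R := k) (A := H)).toAddMonoidHom)
  have ha_apply (y : H) : a y = χ (Coalgebra.counit (R := k) y) := rfl
  have ha0 : a ≠ 0 := fun h => hχ <| by
    simpa [ha_apply] using congrArg (fun f : TwistedDual t H => f 1) h
  have hinv (h : H) : h • a = algebraMap k H (Coalgebra.counit (R := k) h) • a := by
    ext y
    rw [TwistedDual.smul_apply, TwistedDual.smul_apply]
    change a (antipode k h * y) = a (antipode k (algebraMap k H _) * y)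
    simp [ha_apply]
  obtain ⟨A, haA, hA⟩ := exists_submodule_extVanish_of_silp_le hH (t := t) (t' := t') hT hT' hn a
  rw [silp_le_iff] at hn
  rw [spli_le_iff]
  intro I _ _ hI
  let := restrictedModule k H A
  let := restrictedModule k H I
  have := restrictedModule_isScalarTower (k := k) (H := H) A
  have := restrictedModule_isScalarTower (k := k) (H := H) I
  exact extVanish_of_silp_of_finite hn I (extVanish_of_injective_of_invariant (k := k)
    (a := (⟨a, haA⟩ : A)) (fun h => Subtype.ext (hinv h))
    (fun h => ha0 (congrArg Subtype.val h)) hA hI)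

end SilpSpli

theorem ENat.le_of_forall_le_natCast {x y : ℕ∞} (h : ∀ n : ℕ, y ≤ n → x ≤ n) : x ≤ y := by
  cases y with
  | top => exact le_top
  | coe n => exact h n le_rfl

/-- Let `H` be a Hopf algebra over a field `k` with bijective antipode.
If `H` is left `ℵ₀`-noetherian, then `l.silp(H) = l.spli(H)`. -/
theorem silp_eq_spli_of_aleph0Noetherian (k : Type u) [Field k]
    (H : Type u) [Ring H] [HopfAlgebra k H]
    (hS : Function.Bijective (HopfAlgebra.antipode (R := k) (A := H)))
    (hH : IsLeftAleph0Noetherian H) :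
    silp H = spli H := by
  exact le_antisymm (ENat.le_of_forall_le_natCast fun n => silp_le_of_spli_le k H hS)
    (ENat.le_of_forall_le_natCast fun n => spli_le_of_silp_le k H hS hH)
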